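/- Moderate deviation achievability for classical-quantum channel coding: Let W be a classical-quantum channel with finite input alphabet X and outputs density operators on ℂ^d, with minimal peripheral information variance V_W > 0, and let (a_n) be a sequence of reals with a_n → 0 and a_n·√n → +∞ as n → ∞. Then limsup_{n→∞} (1/(n·a_n²))·log ε*(n, C_W − a_n) ≤ −1/(2·V_W), where ε*(n,R) is the smallest average error probability among n-blocklength codes with ⌈exp(nR)⌉ messages. -/

import Mathlib

open scoped BigOperators ComplexOrder
open Filter

noncomputable section

namespace MDQ

/-- Functional calculus for Hermitian matrices (junk value `0` otherwise). -/
noncomputable def matFun {d : ℕ} (f : ℝ → ℝ) (A : Matrix (Fin d) (Fin d) ℂ) :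
    Matrix (Fin d) (Fin d) ℂ :=
  if hA : A.IsHermitian then hA.cfc f else 0

/-- Matrix logarithm on the support (`Real.log 0 = 0`). -/
noncomputable def mlog {d : ℕ} (A : Matrix (Fin d) (Fin d) ℂ) : Matrix (Fin d) (Fin d) ℂ :=
  matFun Real.log A

/-- Matrix real power, restricted to the support. -/
noncomputable def mpow {d : ℕ} (A : Matrix (Fin d) (Fin d) ℂ) (p : ℝ) :
    Matrix (Fin d) (Fin d) ℂ :=
  matFun (fun t => if t = 0 then 0 else t ^ p) A

/-- Matrix exponential via functional calculus. -/
noncomputable def mexp {d : ℕ} (A : Matrix (Fin d) (Fin d) ℂ) : Matrix (Fin d) (Fin d) ℂ :=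
  matFun Real.exp A

/-- Orthogonal projection onto the support of a Hermitian matrix. -/
noncomputable def suppProj {d : ℕ} (A : Matrix (Fin d) (Fin d) ℂ) : Matrix (Fin d) (Fin d) ℂ :=
  matFun (fun t => if t = 0 then 0 else 1) A

/-- `A` is a density operator. -/
def IsDensity {d : ℕ} (A : Matrix (Fin d) (Fin d) ℂ) : Prop :=
  A.PosSemidef ∧ A.trace = 1

/-- Real part of the trace. -/
noncomputable def reTr {ι : Type} [Fintype ι] (A : Matrix ι ι ℂ) : ℝ :=
  A.trace.re

/-- supp ρ ⊆ supp σ, phrased via ranges of the associated linear maps. -/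
def SuppLE {d : ℕ} (ρ σ : Matrix (Fin d) (Fin d) ℂ) : Prop :=
  LinearMap.range (Matrix.toLin' ρ) ≤ LinearMap.range (Matrix.toLin' σ)

/-- Quantum relative entropy `D(ρ‖σ)`. -/
noncomputable def qD {d : ℕ} (ρ σ : Matrix (Fin d) (Fin d) ℂ) : ℝ :=
  reTr (ρ * (mlog ρ - mlog σ))

/-- Quantum relative entropy variance `V(ρ‖σ)`. -/
noncomputable def qV {d : ℕ} (ρ σ : Matrix (Fin d) (Fin d) ℂ) : ℝ :=
  reTr (ρ * (mlog ρ - mlog σ) ^ 2) - (qD ρ σ) ^ 2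

/-- The variant relative entropy variance `Ṽ(ρ‖σ)`. -/
noncomputable def qVtilde {d : ℕ} (ρ σ : Matrix (Fin d) (Fin d) ℂ) : ℝ :=
  (∫ t in (0:ℝ)..1,
    reTr (mpow ρ (1 - t) * (mlog ρ - mlog σ) * mpow ρ t * (mlog ρ - mlog σ))) - (qD ρ σ) ^ 2

/-- The quantum Rényi divergence of order zero, `D₀(ρ‖σ) = -log Tr[Π_ρ σ]`. -/
noncomputable def qD0 {d : ℕ} (ρ σ : Matrix (Fin d) (Fin d) ℂ) : ℝ :=
  - Real.log (reTr (suppProj ρ * σ))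

/-- Tensor product of a finite family of `d × d` matrices. -/
noncomputable def tensorSeq {d n : ℕ} (A : Fin n → Matrix (Fin d) (Fin d) ℂ) :
    Matrix (Fin n → Fin d) (Fin n → Fin d) ℂ :=
  Matrix.of fun i j => ∏ k, A k (i k) (j k)

/-- `n`-fold tensor power of a matrix. -/
noncomputable def tensorPow {d : ℕ} (A : Matrix (Fin d) (Fin d) ℂ) (n : ℕ) :
    Matrix (Fin n → Fin d) (Fin n → Fin d) ℂ :=
  tensorSeq (fun _ => A)

/-- Smallest type-I error with type-II error at most `μ`:  `α̂_μ(ρ‖σ)`. -/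
noncomputable def hypoErr {ι : Type} [Fintype ι] [DecidableEq ι]
    (ρ σ : Matrix ι ι ℂ) (μ : ℝ) : ℝ :=
  sInf { a : ℝ | ∃ Q : Matrix ι ι ℂ, Q.PosSemidef ∧ (1 - Q).PosSemidef ∧
    reTr (Q * σ) ≤ μ ∧ a = reTr ((1 - Q) * ρ) }

/-- `P` is a probability distribution on a finite alphabet. -/
def IsProbDist {X : Type} [Fintype X] (P : X → ℝ) : Prop :=
  (∀ x, 0 ≤ P x) ∧ ∑ x, P x = 1

/-- The average output state `PW`. -/
noncomputable def avgState {X : Type} [Fintype X] {d : ℕ}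
    (P : X → ℝ) (W : X → Matrix (Fin d) (Fin d) ℂ) : Matrix (Fin d) (Fin d) ℂ :=
  ∑ x, (P x : ℂ) • W x

/-- Mutual information `I(P, W)`. -/
noncomputable def mutualInfo {X : Type} [Fintype X] {d : ℕ}
    (P : X → ℝ) (W : X → Matrix (Fin d) (Fin d) ℂ) : ℝ :=
  ∑ x, P x * qD (W x) (avgState P W)

/-- Capacity `C_W`. -/
noncomputable def capacity {X : Type} [Fintype X] {d : ℕ}
    (W : X → Matrix (Fin d) (Fin d) ℂ) : ℝ :=
  sSup { c : ℝ | ∃ P : X → ℝ, IsProbDist P ∧ c = mutualInfo P W }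

/-- Conditional information variance `V(P, W)`. -/
noncomputable def infoVar {X : Type} [Fintype X] {d : ℕ}
    (P : X → ℝ) (W : X → Matrix (Fin d) (Fin d) ℂ) : ℝ :=
  ∑ x, P x * qV (W x) (avgState P W)

/-- The variant conditional information variance `Ṽ(P, W)`. -/
noncomputable def infoVarTilde {X : Type} [Fintype X] {d : ℕ}
    (P : X → ℝ) (W : X → Matrix (Fin d) (Fin d) ℂ) : ℝ :=
  ∑ x, P x * qVtilde (W x) (avgState P W)

/-- Minimal peripheral information variance `V_W`. -/
noncomputable def Vmin {X : Type} [Fintype X] {d : ℕ}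
    (W : X → Matrix (Fin d) (Fin d) ℂ) : ℝ :=
  sInf { v : ℝ | ∃ P : X → ℝ, IsProbDist P ∧ mutualInfo P W = capacity W ∧ v = infoVar P W }

/-- Minimal variant peripheral information variance `Ṽ_W`. -/
noncomputable def VminTilde {X : Type} [Fintype X] {d : ℕ}
    (W : X → Matrix (Fin d) (Fin d) ℂ) : ℝ :=
  sInf { v : ℝ | ∃ P : X → ℝ, IsProbDist P ∧ mutualInfo P W = capacity W ∧ v = infoVarTilde P W }

/-- Conditional relative entropy `D(W‖σ|P)`. -/
noncomputable def Dcond {X : Type} [Fintype X] {d : ℕ}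
    (W : X → Matrix (Fin d) (Fin d) ℂ) (σ : Matrix (Fin d) (Fin d) ℂ) (P : X → ℝ) : ℝ :=
  ∑ x, P x * qD (W x) σ

/-- Conditional relative entropy variance `V(W‖σ|P)`. -/
noncomputable def Vcond {X : Type} [Fintype X] {d : ℕ}
    (W : X → Matrix (Fin d) (Fin d) ℂ) (σ : Matrix (Fin d) (Fin d) ℂ) (P : X → ℝ) : ℝ :=
  ∑ x, P x * qV (W x) σ

/-- Conditional order-zero Rényi divergence `D₀(W‖σ|P)`. -/
noncomputable def D0cond {X : Type} [Fintype X] {d : ℕ}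
    (W : X → Matrix (Fin d) (Fin d) ℂ) (σ : Matrix (Fin d) (Fin d) ℂ) (P : X → ℝ) : ℝ :=
  ∑ x, P x * qD0 (W x) σ

/-- The exponent function `E_h(s, P, σ)`. -/
noncomputable def Eh {X : Type} [Fintype X] {d : ℕ}
    (W : X → Matrix (Fin d) (Fin d) ℂ) (s : ℝ) (P : X → ℝ)
    (σ : Matrix (Fin d) (Fin d) ℂ) : ℝ :=
  -(1 + s) * ∑ x, P x * Real.log (reTr (mpow (W x) (1 / (1 + s)) * mpow σ (s / (1 + s))))

/-- The log-Euclidean exponent function `Ẽ_h(s, P, σ)`. -/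
noncomputable def EhTilde {X : Type} [Fintype X] {d : ℕ}
    (W : X → Matrix (Fin d) (Fin d) ℂ) (s : ℝ) (P : X → ℝ)
    (σ : Matrix (Fin d) (Fin d) ℂ) : ℝ :=
  -(1 + s) * ∑ x, P x *
    Real.log (reTr (mexp ((((1 + s)⁻¹ : ℝ) : ℂ) • (mlog (W x) + ((s : ℝ) : ℂ) • mlog σ))))

/-- The modified auxiliary function `Ẽ₀(s, P, σ)`. -/
noncomputable def E0Tilde {X : Type} [Fintype X] {d : ℕ}
    (W : X → Matrix (Fin d) (Fin d) ℂ) (s : ℝ) (P : X → ℝ)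
    (σ : Matrix (Fin d) (Fin d) ℂ) : ℝ :=
  - Real.log (∑ x, P x * reTr (mpow (W x) (1 - s) * mpow σ s))

/-- The sphere-packing exponent `E_sp^{(2)}(R, P, σ)`. -/
noncomputable def Esp2 {X : Type} [Fintype X] {d : ℕ}
    (W : X → Matrix (Fin d) (Fin d) ℂ) (R : ℝ) (P : X → ℝ)
    (σ : Matrix (Fin d) (Fin d) ℂ) : ℝ :=
  sSup { e : ℝ | ∃ s : ℝ, 0 ≤ s ∧ e = Eh W s P σ - s * R }

/-- The sphere-packing exponent `Ẽ_sp(R, P, σ)`. -/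
noncomputable def EspTilde {X : Type} [Fintype X] {d : ℕ}
    (W : X → Matrix (Fin d) (Fin d) ℂ) (R : ℝ) (P : X → ℝ)
    (σ : Matrix (Fin d) (Fin d) ℂ) : ℝ :=
  sSup { e : ℝ | ∃ s : ℝ, 0 ≤ s ∧ e = EhTilde W s P σ - s * R }

open Classical in
/-- Empirical distribution of a word `x^n ∈ X^n`. -/
noncomputable def empDist {X : Type} [Fintype X] {n : ℕ} (xs : Fin n → X) (x : X) : ℝ :=
  ((Finset.univ.filter fun i => xs i = x).card : ℝ) / n

/-- Smallest average error probability `ε*(n, R)` over all `n`-blocklength codes with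
`⌈exp (n R)⌉` messages. -/
noncomputable def optErr {X : Type} [Fintype X] {d : ℕ}
    (W : X → Matrix (Fin d) (Fin d) ℂ) (n : ℕ) (R : ℝ) : ℝ :=
  sInf { e : ℝ | ∃ (f : Fin ⌈Real.exp (n * R)⌉₊ → Fin n → X)
    (Pov : Fin ⌈Real.exp (n * R)⌉₊ → Matrix (Fin n → Fin d) (Fin n → Fin d) ℂ),
    (∀ m, (Pov m).PosSemidef) ∧ (∑ m, Pov m) = 1 ∧
    e = (1 / (⌈Real.exp (n * R)⌉₊ : ℝ)) *
      ∑ m, (1 - reTr (Pov m * tensorSeq (fun k => W (f m k)))) }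

/-- The binary entropy function. -/
noncomputable def binEnt (p : ℝ) : ℝ :=
  -p * Real.log p - (1 - p) * Real.log (1 - p)

section Overlap

variable {ι : Type} [Fintype ι]

/-- Squared overlaps of the columns of two matrices. -/
def overlap (U V : Matrix ι ι ℂ) (i j : ι) : ℝ := Complex.normSq ((U.conjTranspose * V) i j)

lemma overlap_nonneg (U V : Matrix ι ι ℂ) (i j : ι) : 0 ≤ overlap U V i j := Complex.normSq_nonneg _

lemma overlap_comm (U V : Matrix ι ι ℂ) (i j : ι) : overlap U V i j = overlap V U j i := by
  have : (U.conjTranspose * V) i j = star ((V.conjTranspose * U) j i) := by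
    rw [← Matrix.conjTranspose_apply, Matrix.conjTranspose_mul, Matrix.conjTranspose_conjTranspose]
  rw [overlap, overlap, this, Complex.star_def, Complex.normSq_conj]

end Overlap

section Spectral

variable {ι : Type} [Fintype ι] [DecidableEq ι]

/-- The Hermitian matrix with eigenvector matrix `U` and eigenvalues `f`. -/
def specMat (U : Matrix ι ι ℂ) (f : ι → ℝ) : Matrix ι ι ℂ :=
  U * Matrix.diagonal (fun i => (f i : ℂ)) * U.conjTranspose

lemma specMat_add (U : Matrix ι ι ℂ) (f g : ι → ℝ) :
    specMat U f + specMat U g = specMat U (fun i => f i + g i) := by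
  simp only [specMat, ← add_mul, ← mul_add, Matrix.diagonal_add, Complex.ofReal_add]

lemma specMat_smul (U : Matrix ι ι ℂ) (c : ℝ) (f : ι → ℝ) :
    (c : ℂ) • specMat U f = specMat U (fun i => c * f i) := by
  rw [specMat, ← Matrix.smul_mul, ← Matrix.mul_smul, ← Matrix.diagonal_smul, specMat]
  congr 3; ext i; simp

lemma specMat_mul {U : Matrix ι ι ℂ} (hU : U.conjTranspose * U = 1) (f g : ι → ℝ) :
    specMat U f * specMat U g = specMat U (fun i => f i * g i) := by
  have : specMat U f * specMat U g = U * Matrix.diagonal (fun i => (f i : ℂ)) *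
      (U.conjTranspose * U) * Matrix.diagonal (fun i => (g i : ℂ)) * U.conjTranspose := by
    simp only [specMat, mul_assoc]
  rw [this, hU, mul_one, mul_assoc U, Matrix.diagonal_mul_diagonal]
  simp [specMat]

lemma specMat_const {U : Matrix ι ι ℂ} (hU : U.conjTranspose * U = 1) (c : ℝ) :
    specMat U (fun _ => c) = (c : ℂ) • 1 := by
  rw [specMat, ← Matrix.smul_one_eq_diagonal, Matrix.mul_smul, Matrix.smul_mul, mul_one,
    mul_eq_one_comm.mp hU]

lemma specMat_isHermitian (U : Matrix ι ι ℂ) (f : ι → ℝ) : (specMat U f).IsHermitian := by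
  rw [Matrix.IsHermitian, specMat, Matrix.conjTranspose_mul, Matrix.conjTranspose_mul,
    Matrix.conjTranspose_conjTranspose, Matrix.diagonal_conjTranspose, mul_assoc]
  congr 3; ext i; simp

lemma specMat_posSemidef (U : Matrix ι ι ℂ) {f : ι → ℝ} (hf : ∀ i, 0 ≤ f i) :
    (specMat U f).PosSemidef :=
  (Matrix.PosSemidef.diagonal (fun i => by simpa using hf i)).mul_mul_conjTranspose_same U

lemma aeval_specMat {U : Matrix ι ι ℂ} (hU : U.conjTranspose * U = 1) (f : ι → ℝ)
    (p : Polynomial ℝ) :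
    Polynomial.aeval (specMat U f) p = specMat U (fun i => p.eval (f i)) := by
  induction p using Polynomial.induction_on' with
  | add p q hp hq => simp [hp, hq, specMat_add]
  | monomial n a =>
    have hpow : ∀ n : ℕ, specMat U f ^ n = specMat U (fun i => f i ^ n) := by
      intro n
      induction n with
      | zero => simp [specMat_const hU]
      | succ n ih => rw [pow_succ, ih, specMat_mul hU]; simp [pow_succ]
    rw [Polynomial.aeval_monomial, hpow]
    simp only [Polynomial.eval_monomial]
    rw [← specMat_smul, Algebra.algebraMap_eq_smul_one, smul_mul_assoc, one_mul]
    ext i j; simp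

lemma cfc_specMat {U : Matrix ι ι ℂ} (hU : U.conjTranspose * U = 1) (f : ι → ℝ) (g : ℝ → ℝ) :
    cfc g (specMat U f) = specMat U (fun i => g (f i)) := by
  have hsa : IsSelfAdjoint (specMat U f) := specMat_isHermitian U f
  classical
  let s : Finset ℝ := (Matrix.finite_real_spectrum (A := specMat U f)).toFinset ∪
    Finset.univ.image f
  let p := Lagrange.interpolate s id g
  have hp : ∀ x ∈ s, p.eval x = g x := fun x hx =>
    Lagrange.eval_interpolate_at_node (v := id) g (Set.injOn_id _) hx
  have h1 : cfc g (specMat U f) = cfc (fun x => p.eval x) (specMat U f) :=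
    cfc_congr fun x hx => (hp x (by simp [s, hx])).symm
  rw [h1, cfc_polynomial p _ hsa, aeval_specMat hU]
  congr 1; ext i; exact hp _ (by simp [s])

lemma matFun_eq_cfc {d : ℕ} (g : ℝ → ℝ) {A : Matrix (Fin d) (Fin d) ℂ} (hA : A.IsHermitian) :
    matFun g A = cfc g A := by
  rw [matFun, dif_pos hA, hA.cfc_eq]

lemma matFun_specMat {d : ℕ} {U : Matrix (Fin d) (Fin d) ℂ} (hU : U.conjTranspose * U = 1)
    (f : Fin d → ℝ) (g : ℝ → ℝ) : matFun g (specMat U f) = specMat U (fun i => g (f i)) := by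
  rw [matFun_eq_cfc g (specMat_isHermitian U f), cfc_specMat hU]

/-- A Hermitian matrix is diagonalized by a unitary. -/
lemma exists_specMat {A : Matrix ι ι ℂ} (hA : A.IsHermitian) :
    ∃ U : Matrix ι ι ℂ, U.conjTranspose * U = 1 ∧ ∃ f : ι → ℝ, A = specMat U f := by
  refine ⟨hA.eigenvectorUnitary, ?_, hA.eigenvalues, ?_⟩
  · exact Unitary.coe_star_mul_self hA.eigenvectorUnitary
  · exact hA.spectral_theorem

lemma specMat_eigenvalue_eq {U : Matrix ι ι ℂ} (hU : U.conjTranspose * U = 1) (f : ι → ℝ) (i : ι) :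
    (f i : ℂ) = (U.conjTranspose * specMat U f * U) i i := by
  have : U.conjTranspose * specMat U f * U = (U.conjTranspose * U) *
    Matrix.diagonal (fun i => (f i : ℂ)) * (U.conjTranspose * U) := by
    simp only [specMat, mul_assoc]
  rw [this, hU]; simp

lemma specMat_nonneg_of_posSemidef {U : Matrix ι ι ℂ} (hU : U.conjTranspose * U = 1) {f : ι → ℝ}
    (h : (specMat U f).PosSemidef) (i : ι) : 0 ≤ f i := by
  have h1 := (h.conjTranspose_mul_mul_same U).diag_nonneg (i := i)
  rw [← specMat_eigenvalue_eq hU f i] at h1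
  exact_mod_cast h1

lemma reTr_specMat_mul (U V : Matrix ι ι ℂ) (f g : ι → ℝ) :
    reTr (specMat U f * specMat V g) = ∑ i, ∑ j, f i * g j * overlap U V i j := by
  have h : (specMat U f * specMat V g).trace =
      (Matrix.diagonal (fun i => (f i : ℂ)) * (U.conjTranspose * V) *
        Matrix.diagonal (fun i => (g i : ℂ)) * (U.conjTranspose * V).conjTranspose).trace := by
    rw [Matrix.conjTranspose_mul, Matrix.conjTranspose_conjTranspose]
    simp only [specMat]
    rw [mul_assoc U, mul_assoc U, Matrix.trace_mul_comm U]
    simp only [mul_assoc]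
  rw [reTr, h]
  simp only [Matrix.trace, Matrix.diag, Matrix.mul_apply (M := Matrix.diagonal _ * _ * _),
    Matrix.mul_diagonal, Matrix.diagonal_mul, Matrix.conjTranspose_apply, Complex.re_sum, overlap]
  refine Finset.sum_congr rfl fun i _ => Finset.sum_congr rfl fun j _ => ?_
  rw [show ∀ z : ℂ, (f i : ℂ) * z * g j * star z = ((f i * g j : ℝ) : ℂ) * (z * star z) by
    intro z; push_cast; ring]
  rw [Complex.star_def, Complex.mul_conj, ← Complex.ofReal_mul, Complex.ofReal_re]

lemma overlap_sum_right {U V : Matrix ι ι ℂ} (hU : U.conjTranspose * U = 1)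
    (hV : V.conjTranspose * V = 1) (i : ι) : ∑ j, overlap U V i j = 1 := by
  have h : (U.conjTranspose * V) * (U.conjTranspose * V).conjTranspose = 1 := by
    rw [Matrix.conjTranspose_mul, Matrix.conjTranspose_conjTranspose, mul_assoc, ← mul_assoc V,
      mul_eq_one_comm.mp hV, one_mul, hU]
  have h2 := congrFun (congrFun h i) i
  rw [Matrix.mul_apply] at h2
  simp only [Matrix.conjTranspose_apply, Complex.star_def, Complex.mul_conj,
    Matrix.one_apply_eq] at h2
  exact_mod_cast h2

lemma overlap_sum_left {U V : Matrix ι ι ℂ} (hU : U.conjTranspose * U = 1)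
    (hV : V.conjTranspose * V = 1) (j : ι) : ∑ i, overlap U V i j = 1 := by
  simp_rw [overlap_comm U V]; exact overlap_sum_right hV hU j

lemma overlap_self {U : Matrix ι ι ℂ} (hU : U.conjTranspose * U = 1) (i j : ι) :
    overlap U U i j = if i = j then 1 else 0 := by
  rw [overlap, hU, Matrix.one_apply]; split_ifs <;> simp

lemma reTr_specMat {U : Matrix ι ι ℂ} (hU : U.conjTranspose * U = 1) (f : ι → ℝ) :
    reTr (specMat U f) = ∑ i, f i := by
  have := reTr_specMat_mul U U f (fun _ => 1)
  rw [specMat_const hU] at this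
  simpa [overlap_self hU] using this

end Spectral

section TraceOrder

variable {ι : Type} [Fintype ι]

lemma reTr_add (A B : Matrix ι ι ℂ) : reTr (A + B) = reTr A + reTr B := by
  simp [reTr, Matrix.trace_add]

lemma reTr_sub (A B : Matrix ι ι ℂ) : reTr (A - B) = reTr A - reTr B := by
  simp [reTr, Matrix.trace_sub]

lemma reTr_smul (c : ℝ) (A : Matrix ι ι ℂ) : reTr ((c : ℂ) • A) = c * reTr A := by
  simp [reTr, Matrix.trace_smul]

lemma reTr_sum {κ : Type*} (s : Finset κ) (A : κ → Matrix ι ι ℂ) :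
    reTr (∑ k ∈ s, A k) = ∑ k ∈ s, reTr (A k) := by
  simp [reTr, Matrix.trace_sum]

lemma reTr_mul_comm (A B : Matrix ι ι ℂ) : reTr (A * B) = reTr (B * A) := by
  rw [reTr, Matrix.trace_mul_comm, reTr]

lemma reTr_nonneg {A : Matrix ι ι ℂ} (hA : A.PosSemidef) : 0 ≤ reTr A :=
  (Complex.le_def.mp hA.trace_nonneg).1

open scoped MatrixOrder in
lemma reTr_mul_nonneg {A B : Matrix ι ι ℂ} (hA : A.PosSemidef) (hB : B.PosSemidef) :
    0 ≤ reTr (A * B) := by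
  classical
  obtain ⟨C, rfl⟩ := CStarAlgebra.nonneg_iff_eq_star_mul_self.mp hB.nonneg
  rw [← mul_assoc, reTr_mul_comm, ← mul_assoc]
  exact reTr_nonneg (hA.mul_mul_conjTranspose_same C)

lemma reTr_mul_le_mul {A B C : Matrix ι ι ℂ} (hA : A.PosSemidef) (h : (C - B).PosSemidef) :
    reTr (A * B) ≤ reTr (A * C) := by
  have := reTr_mul_nonneg hA h
  rw [mul_sub, reTr_sub] at this; linarith

end TraceOrder

section OperatorMonotone

variable {ι : Type} [Fintype ι] [DecidableEq ι]

open scoped MatrixOrder Matrix.Norms.L2Operator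

lemma specMat_rpow_le {U V : Matrix ι ι ℂ} (hU : U.conjTranspose * U = 1)
    (hV : V.conjTranspose * V = 1) {f g : ι → ℝ} (hf : ∀ i, 0 ≤ f i) (hg : ∀ i, 0 ≤ g i)
    (h : specMat U f ≤ specMat V g) {s : ℝ} (hs : s ∈ Set.Icc (0 : ℝ) 1) :
    specMat U (fun i => f i ^ s) ≤ specMat V (fun i => g i ^ s) := by
  have key : ∀ {U : Matrix ι ι ℂ} (_ : U.conjTranspose * U = 1) {f : ι → ℝ} (_ : ∀ i, 0 ≤ f i),
      CFC.rpow (specMat U f) s = specMat U (fun i => f i ^ s) := by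
    intro U hU f hf
    have := CFC.rpow_eq_cfc_real (a := specMat U f) (y := s)
      (ha := (specMat_posSemidef U hf).nonneg)
    rw [← cfc_specMat hU f (fun x => x ^ s), ← this]; rfl
  rw [← key hU hf, ← key hV hg]
  exact CFC.rpow_le_rpow hs h

lemma specMat_isStrictlyPositive {U : Matrix ι ι ℂ} (hU : U.conjTranspose * U = 1)
    {f : ι → ℝ} (hf : ∀ i, 0 < f i) : IsStrictlyPositive (specMat U f) := by
  refine IsStrictlyPositive.iff_of_unital.mpr ⟨(specMat_posSemidef U fun i => (hf i).le).nonneg, ?_⟩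
  refine isUnit_iff_exists.mpr ⟨specMat U (fun i => (f i)⁻¹), ?_, ?_⟩ <;>
  · rw [specMat_mul hU]
    have : ∀ i, f i ≠ 0 := fun i => (hf i).ne'
    simp [this, specMat_const hU]

lemma specMat_log_le {U V : Matrix ι ι ℂ} (hU : U.conjTranspose * U = 1)
    (hV : V.conjTranspose * V = 1) {f g : ι → ℝ} (hf : ∀ i, 0 < f i)
    (h : specMat U f ≤ specMat V g) :
    specMat U (fun i => Real.log (f i)) ≤ specMat V (fun i => Real.log (g i)) := by
  have := CFC.log_le_log h (specMat_isStrictlyPositive hU hf)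
  rwa [CFC.log, CFC.log, cfc_specMat hU, cfc_specMat hV] at this

/-- Audenaert's inequality: some test attains a total error at most `Tr A^{1-s} B^s`. -/
lemma exists_test_le_rpow {U V : Matrix ι ι ℂ} (hU : U.conjTranspose * U = 1)
    (hV : V.conjTranspose * V = 1) {f g : ι → ℝ} (hf : ∀ i, 0 ≤ f i) (hg : ∀ i, 0 ≤ g i)
    {s : ℝ} (hs0 : 0 < s) (hs1 : s < 1) :
    ∃ T : Matrix ι ι ℂ, T.PosSemidef ∧ (1 - T).PosSemidef ∧
      reTr ((1 - T) * specMat U f) + reTr (T * specMat V g) ≤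
        ∑ i, ∑ j, f i ^ (1 - s) * g j ^ s * overlap U V i j := by
  obtain ⟨Y, hY, e, he⟩ := exists_specMat
    ((specMat_isHermitian U f).sub (specMat_isHermitian V g))
  set A := specMat U f with hA
  set B := specMat V g with hB
  let D := specMat Y (fun i => max (e i) 0)
  have hD0 : 0 ≤ D := (specMat_posSemidef Y fun i => le_max_right _ _).nonneg
  have hAD : A ≤ B + D := by
    rw [← sub_le_iff_le_add', he]
    rw [← sub_nonneg]
    have : D - specMat Y e = specMat Y (fun i => max (e i) 0 - e i) := by
      rw [sub_eq_iff_eq_add, specMat_add]; simp [D]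
    rw [this]
    exact (specMat_posSemidef Y fun i => sub_nonneg.mpr (le_max_left _ _)).nonneg
  have hB0 : 0 ≤ B := (specMat_posSemidef V hg).nonneg
  obtain ⟨Z, hZ, h, hh⟩ := exists_specMat (Matrix.nonneg_iff_posSemidef.mp (add_nonneg hB0 hD0)).1
  have hh0 : ∀ i, 0 ≤ h i := specMat_nonneg_of_posSemidef hZ (hh ▸ (Matrix.nonneg_iff_posSemidef.mp (add_nonneg hB0 hD0)))
  let Ap := fun r : ℝ => specMat U (fun i => f i ^ r)
  let Bp := fun r : ℝ => specMat V (fun i => g i ^ r)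
  let Cp := fun r : ℝ => specMat Z (fun i => h i ^ r)
  have hsplit : ∀ {U : Matrix ι ι ℂ} (_ : U.conjTranspose * U = 1) {f : ι → ℝ} (_ : ∀ i, 0 ≤ f i),
      specMat U (fun i => f i ^ (1 - s)) * specMat U (fun i => f i ^ s) = specMat U f := by
    intro U hU f hf
    rw [specMat_mul hU]
    congr 1; ext i
    rw [← Real.rpow_add' (hf i) (by norm_num)]; simp
  have hBC : Bp s ≤ Cp s := specMat_rpow_le hV hZ hg hh0 (by rw [← hh]; simpa [hB] using hD0)
    ⟨hs0.le, hs1.le⟩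
  have hBC' : Bp (1 - s) ≤ Cp (1 - s) := specMat_rpow_le hV hZ hg hh0
    (by rw [← hh]; simpa [hB] using hD0) ⟨by linarith, by linarith⟩
  have hAC : Ap s ≤ Cp s := specMat_rpow_le hU hZ hf hh0 (by rw [← hh]; exact hAD)
    ⟨hs0.le, hs1.le⟩
  have hAC' : Ap (1 - s) ≤ Cp (1 - s) := specMat_rpow_le hU hZ hf hh0
    (by rw [← hh]; exact hAD) ⟨by linarith, by linarith⟩
  have hpos : ∀ {U : Matrix ι ι ℂ} {f : ι → ℝ} (_ : ∀ i, 0 ≤ f i) (r : ℝ),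
      (specMat U (fun i => f i ^ r)).PosSemidef :=
    fun hf r => specMat_posSemidef _ fun i => Real.rpow_nonneg (hf i) r
  have e1 : reTr A - reTr (Ap (1 - s) * Bp s) = reTr (Ap (1 - s) * (Ap s - Bp s)) := by
    rw [mul_sub, reTr_sub, hsplit hU hf]
  have e2 : reTr (Ap (1 - s) * (Ap s - Bp s)) ≤ reTr (Ap (1 - s) * (Cp s - Bp s)) :=
    reTr_mul_le_mul (hpos hf _) (by rw [sub_sub_sub_cancel_right]; exact hAC)
  have e3 : reTr (Ap (1 - s) * (Cp s - Bp s)) ≤ reTr (Cp (1 - s) * (Cp s - Bp s)) := by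
    rw [reTr_mul_comm, reTr_mul_comm (Cp (1 - s))]
    exact reTr_mul_le_mul hBC hAC'
  have e4 : reTr (Cp (1 - s) * (Cp s - Bp s)) = reTr (B + D) - reTr (Bp s * Cp (1 - s)) := by
    rw [mul_sub, reTr_sub, hsplit hZ hh0, hh, reTr_mul_comm (Bp s)]
  have e5 : reTr B ≤ reTr (Bp s * Cp (1 - s)) := by
    have : B = Bp (1 - s) * Bp s := (hsplit hV hg).symm
    rw [this, reTr_mul_comm]
    exact reTr_mul_le_mul (hpos hg s) hBC'
  have e6 : reTr (Ap (1 - s) * Bp s) =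
      ∑ i, ∑ j, f i ^ (1 - s) * g j ^ s * overlap U V i j := reTr_specMat_mul _ _ _ _
  refine ⟨specMat Y (fun i => if 0 < e i then 1 else 0), specMat_posSemidef Y fun i => by
    split_ifs <;> norm_num, ?_, ?_⟩
  · have : 1 - specMat Y (fun i => if 0 < e i then 1 else 0) =
        specMat Y (fun i => 1 - if 0 < e i then 1 else 0) := by
      rw [sub_eq_iff_eq_add, specMat_add]; simp [specMat_const hY]
    rw [this]
    exact specMat_posSemidef Y fun i => by split_ifs <;> norm_num
  · set T := specMat Y (fun i => if 0 < e i then 1 else 0) with hT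
    have : reTr ((1 - T) * A) + reTr (T * B) = reTr A - reTr (T * (A - B)) := by
      rw [sub_mul, one_mul, mul_sub, reTr_sub, reTr_sub]; ring
    have hTD : T * (A - B) = D := by
      rw [he, hT, specMat_mul hY]
      congr 1; ext i
      split_ifs with h
      · rw [one_mul, max_eq_left h.le]
      · rw [zero_mul, max_eq_right (not_lt.mp h)]
    rw [this, hTD, ← e6]
    rw [reTr_add] at e4
    linarith

/-- The Hayashi-Nagaoka inequality, with a normalizer `G` such that `G (S + T) G = 1`. -/
lemma exists_normalizer {K : Matrix ι ι ℂ} {c : ℝ} (hc : 0 < c) (hK : (c : ℂ) • 1 ≤ K) :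
    ∃ G : Matrix ι ι ℂ, G.IsHermitian ∧ G * K * G = 1 ∧
      ∀ S T : Matrix ι ι ℂ, S.PosSemidef → (1 - S).PosSemidef → T.PosSemidef → K = S + T →
        1 - G * S * G ≤ (2 : ℂ) • (1 - S) + (4 : ℂ) • T := by
  have hK0 : 0 ≤ K := le_trans (by
    have : (c : ℂ) • (1 : Matrix ι ι ℂ) = specMat 1 (fun _ => c) := (specMat_const (by simp) c).symm
    rw [this]; exact (specMat_posSemidef 1 fun _ => hc.le).nonneg) hK
  obtain ⟨U, hU, f, hf⟩ := exists_specMat (Matrix.nonneg_iff_posSemidef.mp hK0).1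
  have hf0 : ∀ i, 0 < f i := by
    intro i
    have : K - (c : ℂ) • 1 = specMat U (fun i => f i - c) := by
      rw [sub_eq_iff_eq_add, ← specMat_const hU, specMat_add]; simp [hf]
    have h2 := specMat_nonneg_of_posSemidef hU (this ▸ Matrix.le_iff.mp hK) i
    linarith
  let R := specMat U (fun i => √(f i))
  let G := specMat U (fun i => (√(f i))⁻¹)
  have hsq : ∀ i, √(f i) ≠ 0 := fun i => (Real.sqrt_pos.mpr (hf0 i)).ne'
  have hRR : R * R = K := by
    rw [specMat_mul hU, hf]; congr 1; ext i; exact Real.mul_self_sqrt (hf0 i).le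
  have hGR : G * R = 1 := by
    rw [specMat_mul hU]; simp [hsq, specMat_const hU]
  have hRG : R * G = 1 := mul_eq_one_comm.mp hGR
  have hG : G.IsHermitian := specMat_isHermitian _ _
  have hGKG : G * K * G = 1 := by
    rw [← hRR, ← mul_assoc, hGR, one_mul, hRG]
  refine ⟨G, hG, hGKG, fun S T hS hS1 hT hKST => ?_⟩
  have hSR : S ≤ R := by
    obtain ⟨Y, hY, e, he⟩ := exists_specMat hS.1
    have he0 : ∀ i, 0 ≤ e i := specMat_nonneg_of_posSemidef hY (he ▸ hS)
    have he1 : ∀ i, e i ≤ 1 := by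
      intro i
      have : 1 - S = specMat Y (fun i => 1 - e i) := by
        rw [sub_eq_iff_eq_add, he, specMat_add]; simp [specMat_const hY]
      have h2 := specMat_nonneg_of_posSemidef hY (this ▸ hS1) i
      linarith
    have hSK : specMat Y e ≤ specMat U f := by
      rw [← he, ← hf, hKST]; simpa using hT.nonneg
    have h1 := specMat_rpow_le hY hU he0 (fun i => (hf0 i).le) hSK
      (s := 1 / 2) ⟨by norm_num, by norm_num⟩
    simp only [← Real.sqrt_eq_rpow] at h1
    refine le_trans ?_ h1
    rw [he, ← sub_nonneg]
    have : specMat Y (fun i => √(e i)) - specMat Y e = specMat Y (fun i => √(e i) - e i) := by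
      rw [sub_eq_iff_eq_add, specMat_add]; simp
    rw [this]
    refine (specMat_posSemidef Y fun i => ?_).nonneg
    rw [sub_nonneg]
    exact Real.le_sqrt_of_sq_le (by nlinarith [he0 i, he1 i])
  have hconj : ∀ {A B : Matrix ι ι ℂ} (_ : A ≤ B) {C : Matrix ι ι ℂ} (_ : C.IsHermitian),
      C * A * C ≤ C * B * C := by
    intro A B hAB C hC
    rw [← sub_nonneg, ← sub_mul, ← mul_sub]
    have := (Matrix.le_iff.mp hAB).mul_mul_conjTranspose_same C
    rw [hC] at this
    exact this.nonneg
  have hH : (G - 1).IsHermitian := hG.sub Matrix.isHermitian_one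
  have h1 : 1 - G * S * G = G * T * G := by
    rw [sub_eq_iff_eq_add, ← hGKG, hKST]; noncomm_ring
  have h2 : G * T * G ≤ (2 : ℂ) • ((G - 1) * T * (G - 1)) + (2 : ℂ) • T := by
    rw [← sub_nonneg]
    have h3 := hconj hT.nonneg (C := G - (2 : ℂ) • 1)
      (hG.sub (by rw [Matrix.IsHermitian]; simp))
    rw [mul_zero, zero_mul] at h3
    refine h3.trans_eq ?_
    simp only [two_smul]; noncomm_ring
  have h4 : (G - 1) * T * (G - 1) ≤ (G - 1) * K * (G - 1) := by
    refine hconj ?_ hH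
    rw [hKST]; simpa using hS.nonneg
  have h5 : (G - 1) * K * (G - 1) = 1 - R - R + K := by
    have : (G - 1) * K * (G - 1) = G * K * G - (G * R) * R - R * (R * G) + K := by
      simp only [mul_assoc, mul_sub, sub_mul, one_mul, mul_one, ← hRR]; abel
    rw [this, hGKG, hGR, hRG]; simp
  have h6 : 1 - R - R + K ≤ 1 - S + T := by
    have : 1 - S + T - (1 - R - R + K) = (R - S) + (R - S) := by rw [hKST]; abel
    rw [← sub_nonneg, this]
    exact add_nonneg (sub_nonneg.mpr hSR) (sub_nonneg.mpr hSR)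
  have h7 : (G - 1) * T * (G - 1) ≤ 1 - S + T := h4.trans (h5 ▸ h6)
  rw [h1]
  refine h2.trans ?_
  have h8 := add_le_add (add_le_add h7 h7) (le_refl (T + T))
  calc _ = (G - 1) * T * (G - 1) + (G - 1) * T * (G - 1) + (T + T) := by simp only [two_smul]
    _ ≤ _ := h8
    _ = _ := by
      rw [show (4 : ℂ) = 2 + 2 by norm_num, add_smul]; simp only [two_smul]; abel

end OperatorMonotone

section Tensor

variable {d n : ℕ}

lemma tensorSeq_mul (A B : Fin n → Matrix (Fin d) (Fin d) ℂ) :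
    tensorSeq A * tensorSeq B = tensorSeq (fun k => A k * B k) := by
  ext i j
  simp only [tensorSeq, Matrix.mul_apply, Matrix.of_apply, ← Finset.prod_mul_distrib]
  rw [Finset.prod_univ_sum, Fintype.piFinset_univ]

lemma tensorSeq_conjTranspose (A : Fin n → Matrix (Fin d) (Fin d) ℂ) :
    (tensorSeq A).conjTranspose = tensorSeq (fun k => (A k).conjTranspose) := by
  ext i j
  simp [tensorSeq, Matrix.conjTranspose_apply]

lemma tensorSeq_diagonal (f : Fin n → Fin d → ℂ) :
    tensorSeq (fun k => Matrix.diagonal (f k)) = Matrix.diagonal (fun I => ∏ k, f k (I k)) := by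
  ext i j
  simp only [tensorSeq, Matrix.of_apply, Matrix.diagonal_apply]
  split_ifs with h
  · subst h; simp
  · obtain ⟨k, hk⟩ := Function.ne_iff.mp h
    exact Finset.prod_eq_zero (Finset.mem_univ k) (by simp [hk])

lemma tensorSeq_one : tensorSeq (fun _ : Fin n => (1 : Matrix (Fin d) (Fin d) ℂ)) = 1 := by
  simpa using tensorSeq_diagonal (d := d) (n := n) (fun _ _ => 1)

lemma tensorSeq_unitary {U : Fin n → Matrix (Fin d) (Fin d) ℂ}
    (hU : ∀ k, (U k).conjTranspose * U k = 1) :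
    (tensorSeq U).conjTranspose * tensorSeq U = 1 := by
  rw [tensorSeq_conjTranspose, tensorSeq_mul]
  simp_rw [hU]; exact tensorSeq_one

lemma tensorSeq_specMat (U : Fin n → Matrix (Fin d) (Fin d) ℂ) (f : Fin n → Fin d → ℝ) :
    tensorSeq (fun k => specMat (U k) (f k)) =
      specMat (tensorSeq U) (fun I => ∏ k, f k (I k)) := by
  simp only [specMat, Complex.ofReal_prod]
  rw [← tensorSeq_diagonal (fun k i => (f k i : ℂ)), tensorSeq_conjTranspose, tensorSeq_mul,
    tensorSeq_mul]

lemma overlap_tensorSeq (U V : Fin n → Matrix (Fin d) (Fin d) ℂ) (I J : Fin n → Fin d) :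
    overlap (tensorSeq U) (tensorSeq V) I J = ∏ k, overlap (U k) (V k) (I k) (J k) := by
  rw [overlap, tensorSeq_conjTranspose, tensorSeq_mul]
  simp [tensorSeq, overlap, map_prod]

lemma reTr_tensorSeq (A : Fin n → Matrix (Fin d) (Fin d) ℂ) (hA : ∀ k, (A k).trace = 1) :
    (tensorSeq A).trace = 1 := by
  have : (tensorSeq A).trace = ∏ k, (A k).trace := by
    simp only [Matrix.trace, Matrix.diag, tensorSeq, Matrix.of_apply]
    rw [Finset.prod_univ_sum, Fintype.piFinset_univ]
  rw [this]; simp [hA]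

lemma tensorSeq_posSemidef {A : Fin n → Matrix (Fin d) (Fin d) ℂ} (hA : ∀ k, (A k).PosSemidef) :
    (tensorSeq A).PosSemidef := by
  choose U hU f hf using fun k => exists_specMat (hA k).1
  have : A = fun k => specMat (U k) (f k) := funext hf
  rw [this, tensorSeq_specMat]
  refine specMat_posSemidef _ fun I => Finset.prod_nonneg fun k _ => ?_
  exact specMat_nonneg_of_posSemidef (hU k) (hf k ▸ hA k) _

lemma sum_smul_tensorSeq {X : Type} [Fintype X] (P : X → ℝ)
    (W : X → Matrix (Fin d) (Fin d) ℂ) :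
    ∑ x : Fin n → X, ((∏ k, P (x k) : ℝ) : ℂ) • tensorSeq (fun k => W (x k)) =
      tensorSeq (fun _ => avgState P W) := by
  ext i j
  simp only [tensorSeq, Matrix.sum_apply, Matrix.smul_apply, Matrix.of_apply, avgState,
    smul_eq_mul, Complex.ofReal_prod, ← Finset.prod_mul_distrib]
  rw [Finset.prod_univ_sum, Fintype.piFinset_univ]

end Tensor

section ProductWeights

lemma sum_prod_mul_apply {κ Y : Type} [Fintype κ] [DecidableEq κ] [Fintype Y] {P : Y → ℝ}
    (hP : ∑ y, P y = 1) (m : κ) (g : Y → ℝ) :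
    ∑ f : κ → Y, (∏ k, P (f k)) * g (f m) = ∑ y, P y * g y := by
  have h : ∀ f : κ → Y, (∏ k, P (f k)) * g (f m) =
      ∏ k, P (f k) * (if k = m then g (f k) else 1) := by
    intro f; rw [Finset.prod_mul_distrib]; simp
  have h2 := Finset.prod_univ_sum (ι := κ) (fun _ => (Finset.univ : Finset Y))
    (fun k y => P y * (if k = m then g y else 1))
  rw [Fintype.piFinset_univ] at h2
  rw [Finset.sum_congr rfl fun f _ => h f, ← h2, Finset.prod_eq_single m]
  · simp
  · intro k _ hk; simp [hk, hP]
  · simp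

lemma sum_prod_mul_apply_two {κ Y : Type} [Fintype κ] [DecidableEq κ] [Fintype Y] {P : Y → ℝ}
    (hP : ∑ y, P y = 1) {m m' : κ} (hm : m' ≠ m) (g : Y → Y → ℝ) :
    ∑ f : κ → Y, (∏ k, P (f k)) * g (f m) (f m') = ∑ y, ∑ y', P y * P y' * g y y' := by
  classical
  have h1 : ∀ y : Y, ∑ f : κ → Y, (∏ k, P (f k)) * ((if f m = y then 1 else 0) * g y (f m')) =
      P y * ∑ y', P y' * g y y' := by
    intro y
    have h : ∀ f : κ → Y, (∏ k, P (f k)) * ((if f m = y then 1 else 0) * g y (f m')) =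
        ∏ k, P (f k) * ((if k = m then (if f k = y then 1 else 0) else 1) *
          (if k = m' then g y (f k) else 1)) := by
      intro f; rw [Finset.prod_mul_distrib, Finset.prod_mul_distrib]; simp
    have h2 := Finset.prod_univ_sum (ι := κ) (fun _ => (Finset.univ : Finset Y))
      (fun k z => P z * ((if k = m then (if z = y then 1 else 0) else 1) *
          (if k = m' then g y z else 1)))
    rw [Fintype.piFinset_univ] at h2
    rw [Finset.sum_congr rfl fun f _ => h f, ← h2, ← Finset.prod_subset
      (Finset.subset_univ {m, m'}), Finset.prod_pair hm.symm]
    · simp [hm, hm.symm]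
    · intro k _ hk
      simp only [Finset.mem_insert, Finset.mem_singleton, not_or] at hk
      simp [hk.1, hk.2, hP]
  calc _ = ∑ f : κ → Y, ∑ y, (∏ k, P (f k)) * ((if f m = y then 1 else 0) * g y (f m')) := by
        refine Finset.sum_congr rfl fun f _ => ?_
        simp
    _ = _ := by
        rw [Finset.sum_comm]
        refine Finset.sum_congr rfl fun y _ => ?_
        rw [h1, Finset.mul_sum]
        simp [mul_assoc]

end ProductWeights

section RandomCoding

variable {ι Y : Type} [Fintype ι] [DecidableEq ι] [Fintype Y]

open scoped MatrixOrder

lemma exists_povm_le {M : ℕ} (hM : 0 < M) (S : Fin M → Matrix ι ι ℂ) (hS : ∀ m, (S m).PosSemidef)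
    (hS1 : ∀ m, (1 - S m).PosSemidef) {η : ℝ} (hη : 0 < η)
    (hSη : ∀ m, (S m - (η : ℂ) • 1).PosSemidef) :
    ∃ Pov : Fin M → Matrix ι ι ℂ, (∀ m, (Pov m).PosSemidef) ∧ ∑ m, Pov m = 1 ∧
      ∀ m, ∀ ρ : Matrix ι ι ℂ, ρ.PosSemidef → ρ.trace = 1 →
        1 - reTr (Pov m * ρ) ≤ 2 * reTr ((1 - S m) * ρ) +
          4 * ∑ m' ∈ Finset.univ.erase m, reTr (S m' * ρ) := by
  have hsplit : ∀ m, ∑ m, S m = S m + ∑ m' ∈ Finset.univ.erase m, S m' := fun m =>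
    (Finset.add_sum_erase _ _ (Finset.mem_univ m)).symm
  have hrest : ∀ m, 0 ≤ ∑ m' ∈ Finset.univ.erase m, S m' := fun m =>
    Finset.sum_nonneg fun m' _ => (hS m').nonneg
  have hK : (η : ℂ) • 1 ≤ ∑ m, S m := by
    rw [hsplit ⟨0, hM⟩]
    exact le_add_of_le_of_nonneg (Matrix.le_iff.mpr (hSη _)) (hrest _)
  obtain ⟨G, hG, hGKG, hHN⟩ := exists_normalizer hη hK
  refine ⟨fun m => G * S m * G, fun m => ?_, ?_, fun m ρ hρ hρ1 => ?_⟩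
  · have := (hS m).mul_mul_conjTranspose_same G
    rwa [hG] at this
  · rw [← Finset.sum_mul, ← Finset.mul_sum, hGKG]
  · have h := hHN (S m) _ (hS m) (hS1 m) (Matrix.nonneg_iff_posSemidef.mp (hrest m)) (hsplit m)
    have h2 := reTr_mul_le_mul hρ (Matrix.le_iff.mp h)
    rw [mul_sub, mul_one, reTr_sub, mul_add, Matrix.mul_smul, Matrix.mul_smul, reTr_add,
      show (2 : ℂ) = ((2 : ℝ) : ℂ) by norm_num, show (4 : ℂ) = ((4 : ℝ) : ℂ) by norm_num,
      reTr_smul, reTr_smul, Finset.mul_sum, reTr_sum, reTr_mul_comm ρ, reTr_mul_comm ρ] at h2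
    have h3 : reTr ρ = 1 := by simp [reTr, hρ1]
    rw [h3] at h2
    simp_rw [reTr_mul_comm ρ] at h2
    exact h2

/-- Random coding bound with tests `T y` for each codeword `y`. -/
lemma exists_code_le {P : Y → ℝ} (hP0 : ∀ y, 0 ≤ P y) (hP1 : ∑ y, P y = 1)
    (ρ : Y → Matrix ι ι ℂ) (hρ : ∀ y, (ρ y).PosSemidef) (hρ1 : ∀ y, (ρ y).trace = 1)
    (T : Y → Matrix ι ι ℂ) (hT : ∀ y, (T y).PosSemidef) (hT1 : ∀ y, (1 - T y).PosSemidef)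
    {M : ℕ} (hM : 0 < M) {η : ℝ} (hη : 0 < η) (hη1 : η ≤ 1) :
    ∃ f : Fin M → Y, ∃ Pov : Fin M → Matrix ι ι ℂ, (∀ m, (Pov m).PosSemidef) ∧ ∑ m, Pov m = 1 ∧
      (1 / (M : ℝ)) * ∑ m, (1 - reTr (Pov m * ρ (f m))) ≤
        4 * ∑ y, P y * (reTr ((1 - T y) * ρ y) + M * reTr (T y * ∑ y', (P y' : ℂ) • ρ y')) +
          4 * M * η := by
  have hMR : (0 : ℝ) < M := by exact_mod_cast hM
  set σ := ∑ y', (P y' : ℂ) • ρ y' with hσ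
  let S : Y → Matrix ι ι ℂ := fun y => ((1 - η : ℝ) : ℂ) • T y + (η : ℂ) • 1
  have hone : (1 : Matrix ι ι ℂ).PosSemidef := Matrix.PosSemidef.one
  have hsm : ∀ {A : Matrix ι ι ℂ} {c : ℝ}, A.PosSemidef → 0 ≤ c → ((c : ℂ) • A).PosSemidef :=
    fun hA hc => hA.smul (by exact_mod_cast hc)
  have hSη : ∀ y, (S y - (η : ℂ) • 1).PosSemidef := fun y => by
    simpa [S] using hsm (hT y) (sub_nonneg.mpr hη1)
  have hS0 : ∀ y, (S y).PosSemidef := fun y =>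
    (hsm (hT y) (sub_nonneg.mpr hη1)).add (hsm hone hη.le)
  have hSsub : ∀ y, 1 - S y = ((1 - η : ℝ) : ℂ) • (1 - T y) := fun y => by
    simp only [S, Complex.ofReal_sub, Complex.ofReal_one, sub_smul, smul_sub, one_smul]; abel
  have hS1 : ∀ y, (1 - S y).PosSemidef := fun y => by
    rw [hSsub]; exact hsm (hT1 y) (sub_nonneg.mpr hη1)
  choose Pov hPov hPov1 herr using fun f : Fin M → Y =>
    exists_povm_le hM (fun m => S (f m)) (fun m => hS0 _) (fun m => hS1 _) hη (fun m => hSη _)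
  let E : (Fin M → Y) → ℝ := fun f => (1 / (M : ℝ)) * ∑ m, (1 - reTr (Pov f m * ρ (f m)))
  let w : (Fin M → Y) → ℝ := fun f => ∏ m, P (f m)
  have hw0 : ∀ f, 0 ≤ w f := fun f => Finset.prod_nonneg fun m _ => hP0 _
  have hw1 : ∑ f, w f = 1 := by
    have := sum_prod_mul_apply hP1 (⟨0, hM⟩ : Fin M) (fun _ => 1)
    simpa [hP1] using this
  set α := ∑ y, P y * reTr ((1 - S y) * ρ y) with hα
  set β := ∑ y, P y * reTr (S y * σ) with hβ
  have hβ2 : ∑ y, ∑ y', P y * P y' * reTr (S y' * ρ y) = β := by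
    rw [Finset.sum_comm]
    refine Finset.sum_congr rfl fun y' _ => ?_
    rw [hσ, Finset.mul_sum, reTr_sum, Finset.mul_sum]
    refine Finset.sum_congr rfl fun y _ => ?_
    rw [Matrix.mul_smul, reTr_smul]; ring
  have hσ0 : σ.PosSemidef := Matrix.posSemidef_sum _ fun y _ => hsm (hρ y) (hP0 y)
  have hσ1 : reTr σ = 1 := by
    rw [hσ, reTr_sum]
    simp only [reTr_smul]
    rw [← hP1]
    refine Finset.sum_congr rfl fun y _ => ?_
    simp [reTr, hρ1]
  have hβ0 : 0 ≤ β := Finset.sum_nonneg fun y _ => mul_nonneg (hP0 y) (reTr_mul_nonneg (hS0 y) hσ0)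
  have hEavg : ∑ f, w f * E f ≤ 2 * α + 4 * (M * β) := by
    have h1 : ∑ f, w f * E f ≤ ∑ f, w f * ((1 / (M : ℝ)) * ∑ m, (2 * reTr ((1 - S (f m)) * ρ (f m))
        + 4 * ∑ m' ∈ Finset.univ.erase m, reTr (S (f m') * ρ (f m)))) := by
      refine Finset.sum_le_sum fun f _ => mul_le_mul_of_nonneg_left ?_ (hw0 f)
      refine mul_le_mul_of_nonneg_left ?_ (by positivity)
      exact Finset.sum_le_sum fun m _ => herr f m _ (hρ _) (hρ1 _)
    have h2 : ∑ f, w f * ((1 / (M : ℝ)) * ∑ m, (2 * reTr ((1 - S (f m)) * ρ (f m))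
        + 4 * ∑ m' ∈ Finset.univ.erase m, reTr (S (f m') * ρ (f m)))) =
        (1 / (M : ℝ)) * ∑ m : Fin M, (2 * ∑ f, w f * reTr ((1 - S (f m)) * ρ (f m)) +
          4 * ∑ m' ∈ Finset.univ.erase m, ∑ f, w f * reTr (S (f m') * ρ (f m))) := by
      simp only [Finset.mul_sum, mul_add, Finset.sum_add_distrib]
      congr 1
      · rw [Finset.sum_comm]
        refine Finset.sum_congr rfl fun m _ => Finset.sum_congr rfl fun f _ => by ring
      · rw [Finset.sum_comm]
        refine Finset.sum_congr rfl fun m _ => ?_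
        rw [Finset.sum_comm]
        refine Finset.sum_congr rfl fun m _ => Finset.sum_congr rfl fun f _ => by ring
    have h3 : ∀ m : Fin M, ∑ f, w f * reTr ((1 - S (f m)) * ρ (f m)) = α := fun m =>
      sum_prod_mul_apply hP1 m (fun y => reTr ((1 - S y) * ρ y))
    have h4 : ∀ m : Fin M, ∑ m' ∈ Finset.univ.erase m, ∑ f, w f * reTr (S (f m') * ρ (f m)) ≤
        M * β := by
      intro m
      rw [Finset.sum_congr rfl fun m' hm' => (sum_prod_mul_apply_two hP1
        (Finset.ne_of_mem_erase hm') (fun y y' => reTr (S y' * ρ y))).trans hβ2]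
      rw [Finset.sum_const, nsmul_eq_mul]
      refine mul_le_mul_of_nonneg_right ?_ hβ0
      exact_mod_cast (Finset.card_le_univ _).trans (by simp)
    refine h1.trans (h2.trans_le ?_)
    calc _ ≤ (1 / (M : ℝ)) * ∑ m : Fin M, (2 * α + 4 * (M * β)) := by
          refine mul_le_mul_of_nonneg_left (Finset.sum_le_sum fun m _ => ?_) (by positivity)
          rw [h3]; linarith [h4 m]
      _ = _ := by
          rw [Finset.sum_const, Finset.card_univ, Fintype.card_fin, nsmul_eq_mul]
          field_simp
  obtain ⟨f, -, hf⟩ : ∃ f ∈ Finset.univ, w f * E f ≤ w f * (2 * α + 4 * (M * β)) ∧ 0 < w f := by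
    by_contra! hcon
    have h5 : ∑ f, w f * (2 * α + 4 * (M * β)) < ∑ f, w f * E f := by
      obtain ⟨f0, hf0⟩ : ∃ f, 0 < w f := by
        by_contra! h6
        have : ∑ f, w f ≤ 0 := Finset.sum_nonpos fun f _ => h6 f
        linarith
      refine Finset.sum_lt_sum (fun f hf => ?_) ⟨f0, Finset.mem_univ _, ?_⟩
      · by_contra! h7
        have := le_antisymm (hcon f hf h7.le) (hw0 f)
        simp [this] at h7
      · by_contra! h7
        exact absurd hf0 (not_lt.mpr (hcon f0 (Finset.mem_univ _) h7))
    rw [← Finset.sum_mul, hw1, one_mul] at h5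
    linarith
  refine ⟨f, Pov f, hPov f, hPov1 f, ?_⟩
  refine (le_of_mul_le_mul_left hf.1 hf.2).trans ?_
  have hα2 : α ≤ ∑ y, P y * reTr ((1 - T y) * ρ y) := by
    refine Finset.sum_le_sum fun y _ => mul_le_mul_of_nonneg_left ?_ (hP0 y)
    rw [hSsub, Matrix.smul_mul, reTr_smul]
    have := reTr_mul_nonneg (hT1 y) (hρ y)
    nlinarith
  have hα0 : 0 ≤ ∑ y, P y * reTr ((1 - T y) * ρ y) :=
    Finset.sum_nonneg fun y _ => mul_nonneg (hP0 y) (reTr_mul_nonneg (hT1 y) (hρ y))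
  have hβ3 : β ≤ ∑ y, P y * reTr (T y * σ) + η := by
    have : ∑ y, P y * reTr (T y * σ) + η = ∑ y, P y * (reTr (T y * σ) + η) := by
      simp only [mul_add, Finset.sum_add_distrib, ← Finset.sum_mul, hP1, one_mul]
    rw [this]
    refine Finset.sum_le_sum fun y _ => mul_le_mul_of_nonneg_left ?_ (hP0 y)
    simp only [S, add_mul, Matrix.smul_mul, one_mul, reTr_add, reTr_smul, hσ1]
    have := reTr_mul_nonneg (hT y) hσ0
    nlinarith
  have hβ4 : M * β ≤ M * (∑ y, P y * reTr (T y * σ) + η) :=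
    mul_le_mul_of_nonneg_left hβ3 hMR.le
  have : ∑ y, P y * (reTr ((1 - T y) * ρ y) + M * reTr (T y * σ)) =
      ∑ y, P y * reTr ((1 - T y) * ρ y) + M * ∑ y, P y * reTr (T y * σ) := by
    rw [Finset.mul_sum, ← Finset.sum_add_distrib]
    exact Finset.sum_congr rfl fun y _ => by ring
  rw [this]
  linarith

end RandomCoding

section Achievability

variable {X : Type} [Fintype X] {d n : ℕ}

lemma prod_sum_sum (F : Fin n → Fin d → Fin d → ℝ) :
    ∏ k, ∑ i, ∑ j, F k i j = ∑ I : Fin n → Fin d, ∑ J : Fin n → Fin d, ∏ k, F k (I k) (J k) := by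
  rw [Finset.prod_univ_sum, Fintype.piFinset_univ]
  refine Finset.sum_congr rfl fun I _ => ?_
  rw [Finset.prod_univ_sum, Fintype.piFinset_univ]

lemma reTr_mul_density_le {ι : Type} [Fintype ι] [DecidableEq ι] {T ρ : Matrix ι ι ℂ}
    (hT : (1 - T).PosSemidef) (hρ : ρ.PosSemidef) (hρ1 : ρ.trace = 1) : reTr (T * ρ) ≤ 1 := by
  have := reTr_mul_nonneg hT hρ
  rw [sub_mul, one_mul, reTr_sub] at this
  have h : reTr ρ = 1 := by simp [reTr, hρ1]
  linarith

lemma one_sub_povm_posSemidef {ι : Type} [Fintype ι] [DecidableEq ι] {M : ℕ}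
    {Pov : Fin M → Matrix ι ι ℂ} (h0 : ∀ m, (Pov m).PosSemidef) (h1 : ∑ m, Pov m = 1) (m : Fin M) :
    (1 - Pov m).PosSemidef := by
  rw [← h1, ← Finset.add_sum_erase _ _ (Finset.mem_univ m), add_sub_cancel_left]
  exact Matrix.posSemidef_sum _ fun k _ => h0 k

lemma optErr_le {W : X → Matrix (Fin d) (Fin d) ℂ} (hW : ∀ x, IsDensity (W x)) {R e : ℝ}
    (f : Fin ⌈Real.exp (n * R)⌉₊ → Fin n → X)
    (Pov : Fin ⌈Real.exp (n * R)⌉₊ → Matrix (Fin n → Fin d) (Fin n → Fin d) ℂ)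
    (h0 : ∀ m, (Pov m).PosSemidef) (h1 : ∑ m, Pov m = 1)
    (he : (1 / (⌈Real.exp (n * R)⌉₊ : ℝ)) *
      ∑ m, (1 - reTr (Pov m * tensorSeq (fun k => W (f m k)))) ≤ e) : optErr W n R ≤ e := by
  refine le_trans (csInf_le ⟨0, ?_⟩ ⟨f, Pov, h0, h1, rfl⟩) he
  rintro _ ⟨f, Pov, h0, h1, rfl⟩
  refine mul_nonneg (by positivity) (Finset.sum_nonneg fun m _ => ?_)
  exact sub_nonneg.mpr (reTr_mul_density_le (one_sub_povm_posSemidef h0 h1 m)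
    (tensorSeq_posSemidef fun k => (hW _).1) (reTr_tensorSeq _ fun k => (hW _).2))

lemma optErr_le_pow {W : X → Matrix (Fin d) (Fin d) ℂ} (hW : ∀ x, IsDensity (W x))
    {P : X → ℝ} (hP : IsProbDist P) {U : X → Matrix (Fin d) (Fin d) ℂ}
    (hU : ∀ x, (U x).conjTranspose * U x = 1) {l : X → Fin d → ℝ}
    (hl : ∀ x, W x = specMat (U x) (l x)) (hl0 : ∀ x i, 0 ≤ l x i)
    {V : Matrix (Fin d) (Fin d) ℂ} (hV : V.conjTranspose * V = 1) {μ : Fin d → ℝ}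
    (hμ : avgState P W = specMat V μ) (hμ0 : ∀ j, 0 ≤ μ j) {s : ℝ} (hs0 : 0 < s) (hs1 : s < 1)
    (n : ℕ) (R : ℝ) :
    optErr W n R ≤ 4 * (⌈Real.exp (n * R)⌉₊ : ℝ) ^ s *
      (∑ x, P x * ∑ i, ∑ j, l x i ^ (1 - s) * μ j ^ s * overlap (U x) V i j) ^ n := by
  set M := ⌈Real.exp (n * R)⌉₊ with hM
  have hM0 : 0 < M := Nat.ceil_pos.mpr (Real.exp_pos _)
  have hMR : (0 : ℝ) < M := by exact_mod_cast hM0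
  have hVn := tensorSeq_unitary (n := n) (fun _ => hV)
  choose T hT hT1 hTs using fun x : Fin n → X => exists_test_le_rpow
    (tensorSeq_unitary (fun k => hU (x k))) hVn (f := fun I => ∏ k, l (x k) (I k))
    (g := fun J => M * ∏ k, μ (J k)) (fun I => Finset.prod_nonneg fun k _ => hl0 _ _)
    (fun J => mul_nonneg hMR.le (Finset.prod_nonneg fun k _ => hμ0 _)) hs0 hs1
  have hρ : ∀ x : Fin n → X, tensorSeq (fun k => W (x k)) =
      specMat (tensorSeq fun k => U (x k)) (fun I => ∏ k, l (x k) (I k)) := fun x => by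
    rw [← tensorSeq_specMat]; simp only [hl]
  have hσ : (M : ℂ) • tensorSeq (fun _ : Fin n => avgState P W) =
      specMat (tensorSeq fun _ => V) (fun J => M * ∏ k, μ (J k)) := by
    rw [hμ, tensorSeq_specMat, ← specMat_smul]; simp
  refine le_of_forall_pos_le_add fun ε hε => ?_
  obtain ⟨η, hη, hη1, hηε⟩ : ∃ η : ℝ, 0 < η ∧ η ≤ 1 ∧ 4 * M * η ≤ ε := by
    refine ⟨min 1 (ε / (4 * M)), by positivity, min_le_left _ _, ?_⟩
    have : min 1 (ε / (4 * M)) ≤ ε / (4 * M) := min_le_right _ _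
    rwa [le_div_iff₀' (by positivity)] at this
  obtain ⟨f, Pov, h0, h1, he⟩ := exists_code_le (P := fun x : Fin n → X => ∏ k, P (x k))
    (fun x => Finset.prod_nonneg fun k _ => hP.1 _)
    (by rw [← Fintype.sum_pow, hP.2, one_pow]) (fun x => tensorSeq (fun k => W (x k)))
    (fun x => tensorSeq_posSemidef fun k => (hW _).1)
    (fun x => reTr_tensorSeq _ fun k => (hW _).2) T hT hT1 hM0 hη hη1
  refine optErr_le hW f Pov h0 h1 (he.trans ?_)
  refine add_le_add ?_ hηε
  rw [mul_assoc]
  refine mul_le_mul_of_nonneg_left ?_ (by norm_num)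
  rw [Fintype.sum_pow, Finset.mul_sum]
  refine Finset.sum_le_sum fun x _ => ?_
  rw [Finset.prod_mul_distrib, prod_sum_sum, mul_left_comm]
  refine mul_le_mul_of_nonneg_left ?_ (Finset.prod_nonneg fun k _ => hP.1 _)
  rw [sum_smul_tensorSeq, ← reTr_smul, ← Matrix.mul_smul, hρ, Complex.ofReal_natCast, hσ]
  refine (hTs x).trans (le_of_eq ?_)
  simp only [Finset.mul_sum]
  refine Finset.sum_congr rfl fun I _ => Finset.sum_congr rfl fun J _ => ?_
  rw [Real.mul_rpow hMR.le (Finset.prod_nonneg fun k _ => hμ0 _), overlap_tensorSeq,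
    Finset.prod_mul_distrib, Finset.prod_mul_distrib, Real.finsetProd_rpow _ _ fun k _ => hl0 _ _,
    Real.finsetProd_rpow _ _ fun k _ => hμ0 _]
  ring

end Achievability

section OneShotConverse

variable {ι : Type} [Fintype ι] [DecidableEq ι]

lemma reTr_sq_mul_specMat {S U V : Matrix ι ι ℂ} (hS : S.IsHermitian)
    (hU : U.conjTranspose * U = 1) (g : ι → ℝ) :
    reTr (S * S * specMat V g) =
      ∑ i, ∑ j, g j * Complex.normSq ((U.conjTranspose * S * V) i j) := by
  have h : (S * S * specMat V g).trace = (Matrix.diagonal (fun j => (g j : ℂ)) *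
      ((U.conjTranspose * S * V).conjTranspose * (U.conjTranspose * S * V))).trace := by
    have h1 : (U.conjTranspose * S * V).conjTranspose * (U.conjTranspose * S * V) =
        V.conjTranspose * (S * S * V) := by
      rw [Matrix.conjTranspose_mul, Matrix.conjTranspose_mul, Matrix.conjTranspose_conjTranspose,
        hS]
      calc _ = V.conjTranspose * S * (U * U.conjTranspose) * S * V := by simp only [mul_assoc]
        _ = _ := by rw [mul_eq_one_comm.mp hU, mul_one]; simp only [mul_assoc]
    rw [h1, specMat, ← mul_assoc, Matrix.trace_mul_comm, ← mul_assoc, ← mul_assoc,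
      Matrix.trace_mul_comm (Matrix.diagonal _)]
    simp only [mul_assoc]
  rw [reTr, h, Finset.sum_comm, Matrix.trace, Complex.re_sum]
  refine Finset.sum_congr rfl fun j _ => ?_
  rw [Matrix.diag_apply, Matrix.diagonal_mul, Complex.re_ofReal_mul, Matrix.mul_apply,
    Complex.re_sum, Finset.mul_sum]
  refine Finset.sum_congr rfl fun i _ => ?_
  rw [Matrix.conjTranspose_apply, Complex.star_def, ← Complex.normSq_eq_conj_mul_self]
  simp

lemma sub_sq_posSemidef {T : Matrix ι ι ℂ} (hT : T.PosSemidef) (hT1 : (1 - T).PosSemidef) :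
    (T - T * T).PosSemidef := by
  obtain ⟨Y, hY, t, rfl⟩ := exists_specMat hT.1
  have ht := specMat_nonneg_of_posSemidef hY hT
  have h1 : 1 - specMat Y t = specMat Y (fun i => 1 - t i) := by
    have h2 : (1 : Matrix ι ι ℂ) = specMat Y (fun _ => 1) := by simp [specMat_const hY]
    rw [sub_eq_iff_eq_add, specMat_add, h2]; simp
  rw [h1] at hT1
  have ht1 := specMat_nonneg_of_posSemidef hY hT1
  have h3 : specMat Y t - specMat Y t * specMat Y t = specMat Y (fun i => t i * (1 - t i)) := by
    rw [sub_eq_iff_eq_add, specMat_mul hY, specMat_add]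
    congr 1; ext i; ring
  rw [h3]
  exact specMat_posSemidef Y fun i => mul_nonneg (ht i) (ht1 i)

lemma half_sum_min_le {U V : Matrix ι ι ℂ} (hU : U.conjTranspose * U = 1)
    (hV : V.conjTranspose * V = 1) {f g : ι → ℝ} (hf : ∀ i, 0 ≤ f i) (hg : ∀ i, 0 ≤ g i)
    {T : Matrix ι ι ℂ} (hT : T.PosSemidef) (hT1 : (1 - T).PosSemidef) :
    (1 / 2) * ∑ i, ∑ j, min (f i) (g j) * overlap U V i j ≤
      reTr ((1 - T) * specMat U f) + reTr (T * specMat V g) := by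
  have h1 : reTr ((1 - T) * (1 - T) * specMat U f) ≤ reTr ((1 - T) * specMat U f) := by
    rw [reTr_mul_comm, reTr_mul_comm (1 - T)]
    exact reTr_mul_le_mul (specMat_posSemidef U hf) (sub_sq_posSemidef hT1 (by simpa using hT))
  have h2 : reTr (T * T * specMat V g) ≤ reTr (T * specMat V g) := by
    rw [reTr_mul_comm, reTr_mul_comm T]
    exact reTr_mul_le_mul (specMat_posSemidef V hg) (sub_sq_posSemidef hT hT1)
  refine le_trans ?_ (add_le_add h1 h2)
  rw [reTr_sq_mul_specMat hT1.1 hV, reTr_sq_mul_specMat hT.1 hU,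
    Finset.sum_comm (f := fun j i => f i *
      Complex.normSq ((V.conjTranspose * (1 - T) * U) j i)), ← Finset.sum_add_distrib,
    Finset.mul_sum]
  refine Finset.sum_le_sum fun i _ => ?_
  rw [← Finset.sum_add_distrib, Finset.mul_sum]
  refine Finset.sum_le_sum fun j _ => ?_
  have hsymm : (V.conjTranspose * (1 - T) * U) j i =
      star ((U.conjTranspose * (1 - T) * V) i j) := by
    rw [← Matrix.conjTranspose_apply, Matrix.conjTranspose_mul, Matrix.conjTranspose_mul,
      Matrix.conjTranspose_conjTranspose, hT1.1, mul_assoc]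
  have hsum : (U.conjTranspose * V) i j = (U.conjTranspose * (1 - T) * V) i j +
      (U.conjTranspose * T * V) i j := by
    rw [← Matrix.add_apply, ← add_mul, ← mul_add]; simp
  rw [hsymm, Complex.star_def, Complex.normSq_conj, overlap, hsum]
  set a := (U.conjTranspose * (1 - T) * V) i j
  set b := (U.conjTranspose * T * V) i j
  have h3 : Complex.normSq (a + b) ≤ 2 * (Complex.normSq a + Complex.normSq b) := by
    simp only [Complex.normSq_apply, Complex.add_re, Complex.add_im]
    nlinarith [sq_nonneg (a.re - b.re), sq_nonneg (a.im - b.im)]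
  have h4 : min (f i) (g j) * Complex.normSq a ≤ f i * Complex.normSq a :=
    mul_le_mul_of_nonneg_right (min_le_left _ _) (Complex.normSq_nonneg _)
  have h5 : min (f i) (g j) * Complex.normSq b ≤ g j * Complex.normSq b :=
    mul_le_mul_of_nonneg_right (min_le_right _ _) (Complex.normSq_nonneg _)
  have h6 := mul_le_mul_of_nonneg_left h3 (le_min (hf i) (hg j))
  linarith

end OneShotConverse

section Tilting

/-- Quantitative lower bound for the lower tail of a sum of independent centred variables. -/
lemma le_prob_sum_le {n : ℕ} {Ω : Type} [Fintype Ω] [DecidableEq Ω] (p Y : Fin n → Ω → ℝ)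
    (hp : ∀ k ω, 0 ≤ p k ω) (hp1 : ∀ k, ∑ ω, p k ω = 1) {B θ : ℝ} (hB : 0 ≤ B)
    (hY : ∀ k ω, p k ω ≠ 0 → |Y k ω| ≤ B) (hmean : ∀ k, ∑ ω, p k ω * Y k ω = 0)
    (hθ : 0 < θ) (hθB : 2 * θ * B ≤ 1) :
    (1 / 4) * Real.exp (-4 * n * θ ^ 2 * B ^ 2) ≤
      ∑ ω : Fin n → Ω, (∏ k, p k (ω k)) *
        (if ∑ k, Y k (ω k) ≤ -θ / 6 * (∑ k, ∑ ω, p k ω * Y k ω ^ 2) + Real.log 2 / θ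
          then 1 else 0) := by
  set v : Fin n → ℝ := fun k => ∑ ω, p k ω * Y k ω ^ 2 with hv
  have hprod : ∀ g : Fin n → Ω → ℝ, ∑ ω : Fin n → Ω, ∏ k, g k (ω k) = ∏ k, ∑ ω, g k ω := fun g => by
    rw [Finset.prod_univ_sum, Fintype.piFinset_univ]
  have hquad : ∀ c e : ℝ, ∀ k, ∑ ω, p k ω * (1 + c * Y k ω + e * Y k ω ^ 2) = 1 + e * v k := by
    intro c e k
    have : ∀ ω, p k ω * (1 + c * Y k ω + e * Y k ω ^ 2) =
        p k ω + c * (p k ω * Y k ω) + e * (p k ω * Y k ω ^ 2) := fun ω => by ring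
    simp only [this, Finset.sum_add_distrib, ← Finset.mul_sum, hp1, hmean, hv]; ring
  have hYB : ∀ k ω, p k ω ≠ 0 → |θ * Y k ω| ≤ 1 / 2 := fun k ω h => by
    rw [abs_mul, abs_of_pos hθ]
    nlinarith [hY k ω h]
  have hv0 : ∀ k, 0 ≤ v k := fun k => Finset.sum_nonneg fun ω _ => mul_nonneg (hp k ω) (sq_nonneg _)
  have hvB : ∀ k, v k ≤ B ^ 2 := fun k => by
    calc v k ≤ ∑ ω, p k ω * B ^ 2 := by
          refine Finset.sum_le_sum fun ω _ => ?_
          by_cases h : p k ω = 0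
          · simp [h]
          · exact mul_le_mul_of_nonneg_left (sq_le_sq' (abs_le.mp (hY k ω h)).1
              (abs_le.mp (hY k ω h)).2) (hp k ω)
      _ = B ^ 2 := by rw [← Finset.sum_mul, hp1, one_mul]
  have hlow : ∀ y : ℝ, |y| ≤ 1 / 2 → 1 + y + y ^ 2 / 3 ≤ Real.exp y := fun y hy => by
    have h := abs_le.mp (Real.exp_bound (x := y) (by linarith) (n := 4) (by norm_num))
    simp only [Finset.sum_range_succ, Finset.sum_range_zero, Nat.factorial] at h
    have hy4 : |y| ^ 4 = y ^ 4 := by rw [← abs_pow]; exact abs_of_nonneg (by positivity)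
    rw [hy4] at h
    norm_num at h
    have hy' := abs_le.mp hy
    have h6 : y ^ 4 ≤ y ^ 2 / 4 := by
      nlinarith [sq_nonneg y, mul_nonneg (sub_nonneg.mpr hy'.1) (sub_nonneg.mpr hy'.2)]
    have h7 : -(y ^ 2 / 2) ≤ y ^ 3 := by nlinarith [mul_nonneg (sq_nonneg y) (sub_nonneg.mpr hy'.1)]
    nlinarith [sq_nonneg y]
  have hup : ∀ y : ℝ, |y| ≤ 1 → Real.exp y ≤ 1 + y + y ^ 2 := fun y hy => by
    have := abs_le.mp (Real.abs_exp_sub_one_sub_id_le hy); linarith [this.2]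
  set S : (Fin n → Ω) → ℝ := fun ω => ∏ k, Real.exp (-θ * Y k (ω k)) with hS
  set q : (Fin n → Ω) → ℝ := fun ω => ∏ k, p k (ω k) with hq
  have hq0 : ∀ ω, 0 ≤ q ω := fun ω => Finset.prod_nonneg fun k _ => hp k _
  have hS0 : ∀ ω, 0 < S ω := fun ω => Finset.prod_pos fun k _ => Real.exp_pos _
  set m := ∑ ω, q ω * S ω with hm
  have hES : Real.exp (θ ^ 2 / 6 * ∑ k, v k) ≤ m := by
    have : m = ∏ k, ∑ ω, p k ω * Real.exp (-θ * Y k ω) := by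
      rw [← hprod (fun k ω => p k ω * Real.exp (-θ * Y k ω))]
      simp only [Finset.prod_mul_distrib, hm, hq, hS]
    rw [this, Finset.mul_sum, Real.exp_sum]
    refine Finset.prod_le_prod (fun k _ => (Real.exp_pos _).le) fun k _ => ?_
    calc Real.exp (θ ^ 2 / 6 * v k) ≤ 1 + θ ^ 2 / 3 * v k := by
          have h1 : θ ^ 2 * v k ≤ 1 / 4 := by
            have : θ ^ 2 * v k ≤ θ ^ 2 * B ^ 2 := mul_le_mul_of_nonneg_left (hvB k) (by positivity)
            nlinarith [mul_nonneg hθ.le hB]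
          have h0 : 0 ≤ θ ^ 2 * v k := mul_nonneg (by positivity) (hv0 k)
          have := hup (θ ^ 2 / 6 * v k) (abs_le.mpr ⟨by linarith, by linarith⟩)
          nlinarith
      _ = ∑ ω, p k ω * (1 + (-θ) * Y k ω + θ ^ 2 / 3 * Y k ω ^ 2) := (hquad _ _ k).symm
      _ ≤ _ := by
          refine Finset.sum_le_sum fun ω _ => ?_
          by_cases h : p k ω = 0
          · simp [h]
          · refine mul_le_mul_of_nonneg_left ?_ (hp k ω)
            have := hlow (-θ * Y k ω) (by rw [neg_mul, abs_neg]; exact hYB k ω h)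
            linarith
  have hES2 : ∑ ω, q ω * S ω ^ 2 ≤ Real.exp (4 * n * θ ^ 2 * B ^ 2) := by
    have : ∑ ω, q ω * S ω ^ 2 = ∏ k, ∑ ω, p k ω * Real.exp (-θ * Y k ω) ^ 2 := by
      rw [← hprod (fun k ω => p k ω * Real.exp (-θ * Y k ω) ^ 2)]
      simp only [Finset.prod_mul_distrib, hq, hS, Finset.prod_pow]
    have he : Real.exp (4 * n * θ ^ 2 * B ^ 2) = ∏ _k : Fin n, Real.exp (4 * θ ^ 2 * B ^ 2) := by
      rw [Finset.prod_const, Finset.card_univ, Fintype.card_fin, ← Real.exp_nat_mul]; ring_nf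
    rw [this, he]
    refine Finset.prod_le_prod (fun k _ => Finset.sum_nonneg fun ω _ =>
      mul_nonneg (hp k ω) (sq_nonneg _)) fun k _ => ?_
    calc _ ≤ ∑ ω, p k ω * (1 + (-2 * θ) * Y k ω + 4 * θ ^ 2 * Y k ω ^ 2) := by
          refine Finset.sum_le_sum fun ω _ => ?_
          by_cases h : p k ω = 0
          · simp [h]
          · refine mul_le_mul_of_nonneg_left ?_ (hp k ω)
            have := hup (2 * (-θ * Y k ω)) (by
              rw [abs_mul, neg_mul, abs_neg, abs_two]; linarith [hYB k ω h])
            rw [← Real.exp_nat_mul]; push_cast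
            linarith
      _ = 1 + 4 * θ ^ 2 * v k := hquad _ _ k
      _ ≤ Real.exp (4 * θ ^ 2 * B ^ 2) := by
          have := Real.add_one_le_exp (4 * θ ^ 2 * B ^ 2)
          nlinarith [hvB k, sq_nonneg θ]
  have hm1 : 1 ≤ m := le_trans (by
    rw [← Real.exp_zero]
    exact Real.exp_le_exp.mpr (mul_nonneg (by positivity) (Finset.sum_nonneg fun k _ => hv0 k))) hES
  set G : (Fin n → Ω) → ℝ := fun ω =>
    if ∑ k, Y k (ω k) ≤ -θ / 6 * (∑ k, v k) + Real.log 2 / θ then 1 else 0 with hG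
  have hGS : ∀ ω, S ω ≤ m / 2 + S ω * G ω := fun ω => by
    by_cases h : ∑ k, Y k (ω k) ≤ -θ / 6 * (∑ k, v k) + Real.log 2 / θ
    · simp only [hG, if_pos h]; linarith
    · simp only [hG, if_neg h]
      rw [not_le] at h
      have h1 : -θ * ∑ k, Y k (ω k) ≤ θ ^ 2 / 6 * (∑ k, v k) - Real.log 2 := by
        have h2 := mul_lt_mul_of_pos_left h hθ
        have h3 : θ * (-θ / 6 * (∑ k, v k) + Real.log 2 / θ) =
          -(θ ^ 2 / 6 * (∑ k, v k)) + Real.log 2 := by field_simp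
        rw [h3] at h2; linarith
      have h4 : S ω = Real.exp (-θ * ∑ k, Y k (ω k)) := by
        rw [Finset.mul_sum, Real.exp_sum]
      have h5 := Real.exp_le_exp.mpr h1
      rw [← h4, Real.exp_sub, Real.exp_log (by norm_num)] at h5
      linarith
  have hG2 : ∀ ω, G ω ^ 2 = G ω := fun ω => by simp only [hG]; split_ifs <;> norm_num
  have hq1 : ∑ ω, q ω = 1 := by
    rw [hprod (fun k ω => p k ω)]; simp [hp1]
  have hhalf : m / 2 ≤ ∑ ω, q ω * (S ω * G ω) := by
    have : m ≤ ∑ ω, q ω * (m / 2 + S ω * G ω) :=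
      Finset.sum_le_sum fun ω _ => mul_le_mul_of_nonneg_left (hGS ω) (hq0 ω)
    simp only [mul_add, Finset.sum_add_distrib, ← Finset.sum_mul, hq1, one_mul] at this
    linarith
  have hCS : (∑ ω, q ω * (S ω * G ω)) ^ 2 ≤ (∑ ω, q ω * S ω ^ 2) * ∑ ω, q ω * G ω := by
    refine Finset.sum_sq_le_sum_mul_sum_of_sq_le_mul _ (fun ω _ => mul_nonneg (hq0 ω) (sq_nonneg _))
      (fun ω _ => ?_) fun ω _ => ?_
    · rw [← hG2]; exact mul_nonneg (hq0 ω) (sq_nonneg _)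
    · refine le_of_eq ?_
      nth_rewrite 2 [← hG2]; ring
  have hPG : 0 ≤ ∑ ω, q ω * G ω := Finset.sum_nonneg fun ω _ => by
    rw [← hG2]; exact mul_nonneg (hq0 ω) (sq_nonneg _)
  have hfin : 1 / 4 ≤ Real.exp (4 * n * θ ^ 2 * B ^ 2) * ∑ ω, q ω * G ω := by
    have := mul_le_mul_of_nonneg_right hES2 hPG
    nlinarith
  have : Real.exp (-4 * n * θ ^ 2 * B ^ 2) * Real.exp (4 * n * θ ^ 2 * B ^ 2) = 1 := by
    rw [← Real.exp_add, ← Real.exp_zero]; ring_nf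
  calc (1 / 4) * Real.exp (-4 * n * θ ^ 2 * B ^ 2) ≤ (Real.exp (4 * n * θ ^ 2 * B ^ 2) *
        ∑ ω, q ω * G ω) * Real.exp (-4 * n * θ ^ 2 * B ^ 2) :=
        mul_le_mul_of_nonneg_right hfin (Real.exp_pos _).le
    _ = ∑ ω, q ω * G ω := by
      rw [mul_comm, ← mul_assoc, this, one_mul]

end Tilting

section EntropyFormulas

variable {d : ℕ}

lemma qD_specMat {U V : Matrix (Fin d) (Fin d) ℂ} (hU : U.conjTranspose * U = 1)
    (hV : V.conjTranspose * V = 1) (f g : Fin d → ℝ) :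
    qD (specMat U f) (specMat V g) =
      ∑ i, ∑ j, f i * overlap U V i j * (Real.log (f i) - Real.log (g j)) := by
  rw [qD, mlog, mlog, matFun_specMat hU, matFun_specMat hV, mul_sub, reTr_sub, specMat_mul hU,
    reTr_specMat hU, reTr_specMat_mul, ← Finset.sum_sub_distrib]
  refine Finset.sum_congr rfl fun i _ => ?_
  rw [← mul_one (f i * Real.log (f i)), ← overlap_sum_right hU hV i, Finset.mul_sum,
    ← Finset.sum_sub_distrib]
  exact Finset.sum_congr rfl fun j _ => by ring

lemma qV_specMat {U V : Matrix (Fin d) (Fin d) ℂ} (hU : U.conjTranspose * U = 1)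
    (hV : V.conjTranspose * V = 1) (f g : Fin d → ℝ) :
    qV (specMat U f) (specMat V g) + qD (specMat U f) (specMat V g) ^ 2 =
      ∑ i, ∑ j, f i * overlap U V i j * (Real.log (f i) - Real.log (g j)) ^ 2 := by
  rw [qV, sub_add_cancel, mlog, mlog, matFun_specMat hU, matFun_specMat hV]
  set A := specMat U (fun i => Real.log (f i))
  set B := specMat V (fun j => Real.log (g j))
  have h : reTr (specMat U f * (A - B) ^ 2) = reTr (specMat U f * A * A) -
      reTr (specMat U f * A * B) - reTr (A * specMat U f * B) + reTr (specMat U f * (B * B)) := by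
    have : reTr (A * specMat U f * B) = reTr (specMat U f * B * A) := by
      rw [mul_assoc, reTr_mul_comm]
    rw [this, ← reTr_sub, ← reTr_sub, ← reTr_add, sq]
    congr 1; noncomm_ring
  rw [h, specMat_mul hU, specMat_mul hU, specMat_mul hU, specMat_mul hV, reTr_specMat hU,
    reTr_specMat_mul, reTr_specMat_mul, reTr_specMat_mul, ← Finset.sum_sub_distrib,
    ← Finset.sum_sub_distrib, ← Finset.sum_add_distrib]
  refine Finset.sum_congr rfl fun i _ => ?_
  rw [← mul_one (f i * Real.log (f i) * Real.log (f i)), ← overlap_sum_right hU hV i,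
    Finset.mul_sum, ← Finset.sum_sub_distrib, ← Finset.sum_sub_distrib, ← Finset.sum_add_distrib]
  exact Finset.sum_congr rfl fun j _ => by ring

lemma sum_mul_overlap {U V : Matrix (Fin d) (Fin d) ℂ} (hU : U.conjTranspose * U = 1)
    (hV : V.conjTranspose * V = 1) (f : Fin d → ℝ) :
    ∑ i, ∑ j, f i * overlap U V i j = ∑ i, f i := by
  simp_rw [← Finset.mul_sum, overlap_sum_right hU hV, mul_one]

lemma qV_specMat_eq_sum_sq {U V : Matrix (Fin d) (Fin d) ℂ} (hU : U.conjTranspose * U = 1)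
    (hV : V.conjTranspose * V = 1) {f : Fin d → ℝ} (hf : ∑ i, f i = 1) (g : Fin d → ℝ) :
    qV (specMat U f) (specMat V g) = ∑ i, ∑ j, f i * overlap U V i j *
      (Real.log (f i) - Real.log (g j) - qD (specMat U f) (specMat V g)) ^ 2 := by
  have h1 := qV_specMat hU hV f g
  have h2 := qD_specMat hU hV f g
  set D := qD (specMat U f) (specMat V g)
  have h4 : ∀ i j, f i * overlap U V i j * (Real.log (f i) - Real.log (g j) - D) ^ 2 =
      f i * overlap U V i j * (Real.log (f i) - Real.log (g j)) ^ 2 -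
        2 * D * (f i * overlap U V i j * (Real.log (f i) - Real.log (g j))) +
        D ^ 2 * (f i * overlap U V i j) := fun i j => by ring
  simp only [h4, Finset.sum_add_distrib, Finset.sum_sub_distrib, ← Finset.mul_sum, ← h1, ← h2,
    overlap_sum_right hU hV, mul_one, hf]
  ring

lemma qV_nonneg {U V : Matrix (Fin d) (Fin d) ℂ} (hU : U.conjTranspose * U = 1)
    (hV : V.conjTranspose * V = 1) {f : Fin d → ℝ} (hf0 : ∀ i, 0 ≤ f i) (hf : ∑ i, f i = 1)
    (g : Fin d → ℝ) : 0 ≤ qV (specMat U f) (specMat V g) := by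
  rw [qV_specMat_eq_sum_sq hU hV hf]
  exact Finset.sum_nonneg fun i _ => Finset.sum_nonneg fun j _ =>
    mul_nonneg (mul_nonneg (hf0 i) (overlap_nonneg _ _ _ _)) (sq_nonneg _)

end EntropyFormulas

section Converse

variable {d n : ℕ}

lemma le_test_error {U : Fin n → Matrix (Fin d) (Fin d) ℂ} (hU : ∀ k, (U k).conjTranspose * U k = 1)
    {f : Fin n → Fin d → ℝ} (hf0 : ∀ k i, 0 ≤ f k i) (hf1 : ∀ k, ∑ i, f k i = 1)
    {V : Matrix (Fin d) (Fin d) ℂ} (hV : V.conjTranspose * V = 1) {μ : Fin d → ℝ}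
    (hμ0 : ∀ j, 0 ≤ μ j) (hdom : ∀ k i j, f k i * overlap (U k) V i j ≠ 0 → 0 < μ j)
    {B θ : ℝ} (hB0 : 0 ≤ B) (hθ : 0 < θ) (hθB : 2 * θ * B ≤ 1)
    (hB : ∀ k i j, |Real.log (f k i) - Real.log (μ j) - qD (specMat (U k) (f k)) (specMat V μ)| ≤ B)
    {b : ℝ} (hb : ∑ k, (qD (specMat (U k) (f k)) (specMat V μ) -
      θ / 6 * qV (specMat (U k) (f k)) (specMat V μ)) + Real.log 2 / θ ≤ b)
    {T : Matrix (Fin n → Fin d) (Fin n → Fin d) ℂ} (hT : T.PosSemidef) (hT1 : (1 - T).PosSemidef) :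
    (1 / 8) * Real.exp (-4 * n * θ ^ 2 * B ^ 2) ≤
      reTr ((1 - T) * tensorSeq (fun k => specMat (U k) (f k))) +
        Real.exp b * reTr (T * tensorSeq (fun _ => specMat V μ)) := by
  set D : Fin n → ℝ := fun k => qD (specMat (U k) (f k)) (specMat V μ) with hD
  have hexp : (Real.exp b : ℂ) • tensorSeq (fun _ : Fin n => specMat V μ) =
      specMat (tensorSeq fun _ => V) (fun J => Real.exp b * ∏ k, μ (J k)) := by
    rw [tensorSeq_specMat, ← specMat_smul]
  have hhalf := half_sum_min_le (tensorSeq_unitary hU) (tensorSeq_unitary (n := n) (fun _ => hV))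
    (f := fun I => ∏ k, f k (I k)) (g := fun J => Real.exp b * ∏ k, μ (J k))
    (fun I => Finset.prod_nonneg fun k _ => hf0 _ _)
    (fun J => mul_nonneg (Real.exp_pos _).le (Finset.prod_nonneg fun k _ => hμ0 _)) hT hT1
  rw [← hexp, ← tensorSeq_specMat, Matrix.mul_smul, reTr_smul] at hhalf
  refine le_trans ?_ hhalf
  have hprob := le_prob_sum_le (n := n) (Ω := Fin d × Fin d)
    (fun k ω => f k ω.1 * overlap (U k) V ω.1 ω.2)
    (fun k ω => Real.log (f k ω.1) - Real.log (μ ω.2) - D k)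
    (fun k ω => mul_nonneg (hf0 _ _) (overlap_nonneg _ _ _ _))
    (fun k => by rw [Fintype.sum_prod_type]; exact (sum_mul_overlap (hU k) hV _).trans (hf1 k))
    hB0 (fun k ω _ => hB k _ _)
    (fun k => by
      rw [Fintype.sum_prod_type]
      simp only [mul_sub (f k _ * _) _ (D k), Finset.sum_sub_distrib]
      rw [hD]
      simp only
      rw [← qD_specMat (hU k) hV]
      simp only [← Finset.sum_mul]
      rw [sum_mul_overlap (hU k) hV, hf1, one_mul, sub_self]) hθ hθB
  have hvar : ∀ k, ∑ ω : Fin d × Fin d, f k ω.1 * overlap (U k) V ω.1 ω.2 *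
      (Real.log (f k ω.1) - Real.log (μ ω.2) - D k) ^ 2 =
      qV (specMat (U k) (f k)) (specMat V μ) := fun k => by
    rw [Fintype.sum_prod_type, qV_specMat_eq_sum_sq (hU k) hV (hf1 k)]
  simp only [hvar] at hprob
  have hmin : ∑ ω : Fin n → Fin d × Fin d, (∏ k, f k (ω k).1 * overlap (U k) V (ω k).1 (ω k).2) *
        (if ∑ k, (Real.log (f k (ω k).1) - Real.log (μ (ω k).2) - D k) ≤
          -θ / 6 * (∑ k, qV (specMat (U k) (f k)) (specMat V μ)) + Real.log 2 / θ then 1 else 0) ≤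
      ∑ I : Fin n → Fin d, ∑ J : Fin n → Fin d, min (∏ k, f k (I k)) (Real.exp b * ∏ k, μ (J k)) *
        overlap (tensorSeq U) (tensorSeq fun _ => V) I J := by
    rw [← Fintype.sum_prod_type', ← (Equiv.arrowProdEquivProdArrow (Fin n) (fun _ => Fin d)
      (fun _ => Fin d)).sum_comp]
    refine Finset.sum_le_sum fun ω _ => ?_
    simp only [Equiv.arrowProdEquivProdArrow, Equiv.coe_fn_mk]
    rw [overlap_tensorSeq, Finset.prod_mul_distrib]
    have hov : 0 ≤ ∏ k, overlap (U k) V (ω k).1 (ω k).2 :=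
      Finset.prod_nonneg fun k _ => overlap_nonneg _ _ _ _
    by_cases hz : ∀ k, f k (ω k).1 * overlap (U k) V (ω k).1 (ω k).2 ≠ 0
    · have hfpos : ∀ k, 0 < f k (ω k).1 := fun k =>
        lt_of_le_of_ne (hf0 _ _) (Ne.symm (left_ne_zero_of_mul (hz k)))
      have hμpos : ∀ k, 0 < μ (ω k).2 := fun k => hdom k _ _ (hz k)
      split_ifs with hev
      · rw [mul_one, min_eq_left]
        have h1 : ∑ k, (Real.log (f k (ω k).1) - Real.log (μ (ω k).2)) ≤ b := by
          rw [Finset.sum_sub_distrib, ← Finset.mul_sum] at hb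
          rw [Finset.sum_sub_distrib] at hev
          linarith
        have h2 : ∏ k, f k (ω k).1 = Real.exp (∑ k, Real.log (f k (ω k).1)) := by
          rw [Real.exp_sum]; exact Finset.prod_congr rfl fun k _ => (Real.exp_log (hfpos k)).symm
        have h3 : ∏ k, μ (ω k).2 = Real.exp (∑ k, Real.log (μ (ω k).2)) := by
          rw [Real.exp_sum]; exact Finset.prod_congr rfl fun k _ => (Real.exp_log (hμpos k)).symm
        rw [h2, h3, ← Real.exp_add]
        rw [Finset.sum_sub_distrib] at h1
        exact Real.exp_le_exp.mpr (by linarith)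
      · rw [mul_zero]
        exact mul_nonneg (le_min (Finset.prod_nonneg fun k _ => hf0 _ _)
          (mul_nonneg (Real.exp_pos _).le (Finset.prod_nonneg fun k _ => hμ0 _))) hov
    · push Not at hz
      obtain ⟨k, hk⟩ := hz
      rw [← Finset.prod_mul_distrib, Finset.prod_eq_zero (Finset.mem_univ k) hk, zero_mul]
      exact mul_nonneg (le_min (Finset.prod_nonneg fun k _ => hf0 _ _)
          (mul_nonneg (Real.exp_pos _).le (Finset.prod_nonneg fun k _ => hμ0 _))) hov
  linarith

open Classical in
lemma sum_word_eq {X : Type} [Fintype X] {n : ℕ} (hn : 0 < n) (xs : Fin n → X) :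
    IsProbDist (empDist xs) ∧ ∀ g : X → ℝ, ∑ k, g (xs k) = n * ∑ x, empDist xs x * g x := by
  have hnR : (0 : ℝ) < n := by exact_mod_cast hn
  have h : ∀ g : X → ℝ, ∑ k, g (xs k) = n * ∑ x, empDist xs x * g x := fun g => by
    rw [Finset.mul_sum, ← Finset.sum_fiberwise (g := xs)]
    refine Finset.sum_congr rfl fun x _ => ?_
    rw [Finset.sum_congr rfl fun k hk => by rw [(Finset.mem_filter.mp hk).2], Finset.sum_const,
      nsmul_eq_mul, empDist]
    field_simp
  refine ⟨⟨fun x => by unfold empDist; positivity, ?_⟩, h⟩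
  have := h (fun _ => 1)
  simp only [mul_one, Finset.sum_const, Finset.card_univ, Fintype.card_fin, nsmul_eq_mul] at this
  field_simp at this
  exact this.symm

lemma le_optErr {X κ : Type} [Fintype X] [Nonempty X] [Fintype κ]
    {W : X → Matrix (Fin d) (Fin d) ℂ} (hW : ∀ x, IsDensity (W x))
    {U : X → Matrix (Fin d) (Fin d) ℂ}
    (hU : ∀ x, (U x).conjTranspose * U x = 1) {l : X → Fin d → ℝ}
    (hl : ∀ x, W x = specMat (U x) (l x)) (hl0 : ∀ x i, 0 ≤ l x i)
    {V : κ → Matrix (Fin d) (Fin d) ℂ} (hV : ∀ a, (V a).conjTranspose * V a = 1)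
    {μ : κ → Fin d → ℝ} (hμ0 : ∀ a j, 0 ≤ μ a j) (hμ1 : ∀ a, ∑ j, μ a j = 1)
    (hdom : ∀ a x i j, l x i * overlap (U x) (V a) i j ≠ 0 → 0 < μ a j)
    {B : ℝ} (hB0 : 0 ≤ B)
    (hB : ∀ a x i j, |Real.log (l x i) - Real.log (μ a j) - qD (W x) (specMat (V a) (μ a))| ≤ B)
    {C v₀ θ₀ : ℝ} (hcov : ∀ Q : X → ℝ, IsProbDist Q → ∃ a, ∀ θ, 0 < θ → θ ≤ θ₀ →
      ∑ x, Q x * (qD (W x) (specMat (V a) (μ a)) - θ * qV (W x) (specMat (V a) (μ a))) ≤ C - θ * v₀)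
    {θ : ℝ} (hθ : 0 < θ) (hθB : 2 * θ * B ≤ 1) (hθ₀ : θ / 6 ≤ θ₀) (hn : 0 < n) (R : ℝ) :
    (1 / 8) * Real.exp (-4 * n * θ ^ 2 * B ^ 2) - Fintype.card κ *
      Real.exp (n * (C - θ / 6 * v₀) + Real.log 2 / θ - n * R) ≤ optErr W n R := by
  have hM0 : 0 < ⌈Real.exp (n * R)⌉₊ := Nat.ceil_pos.mpr (Real.exp_pos _)
  have hMR : (0 : ℝ) < ⌈Real.exp (n * R)⌉₊ := by exact_mod_cast hM0
  have hMe : Real.exp (n * R) ≤ ⌈Real.exp (n * R)⌉₊ := Nat.le_ceil _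
  have hl1 : ∀ x, ∑ i, l x i = 1 := fun x => by
    have := (hW x).2
    rw [← reTr_specMat (hU x), ← hl, reTr, this, Complex.one_re]
  refine le_csInf ?_ ?_
  · refine ⟨_, fun _ _ => Classical.arbitrary X, fun m => if m = ⟨0, hM0⟩ then 1 else 0,
      fun m => ?_, ?_, rfl⟩
    · dsimp only
      split_ifs
      exacts [Matrix.PosSemidef.one, Matrix.PosSemidef.zero]
    · simp
  rintro _ ⟨f, Pov, h0, h1, rfl⟩
  set b := n * (C - θ / 6 * v₀) + Real.log 2 / θ with hbdef
  set r := (1 / 8) * Real.exp (-4 * n * θ ^ 2 * B ^ 2)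
  let σ : κ → Matrix (Fin n → Fin d) (Fin n → Fin d) ℂ := fun a =>
    tensorSeq (fun _ => specMat (V a) (μ a))
  have hσ0 : ∀ a, (σ a).PosSemidef := fun a =>
    tensorSeq_posSemidef fun _ => specMat_posSemidef _ (hμ0 a)
  have hσtr : ∀ a, reTr (σ a) = 1 := fun a => by
    simp only [σ]
    rw [tensorSeq_specMat, reTr_specMat (tensorSeq_unitary fun _ => hV a), ← Fintype.sum_pow, hμ1,
      one_pow]
  have hkey : ∀ m, r ≤ (1 - reTr (Pov m * tensorSeq (fun k => W (f m k)))) +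
      Real.exp b * ∑ a, reTr (Pov m * σ a) := fun m => by
    obtain ⟨hemp, hsum⟩ := sum_word_eq hn (f m)
    obtain ⟨a, ha⟩ := hcov _ hemp
    have h2 := le_test_error (fun k => hU (f m k)) (fun k => hl0 (f m k)) (fun k => hl1 (f m k))
      (hV a) (hμ0 a) (fun k => hdom a (f m k)) hB0 hθ hθB
      (fun k i j => by rw [← hl]; exact hB a (f m k) i j) (b := b) (by
        simp only [← hl]
        rw [hsum (fun x => qD (W x) (specMat (V a) (μ a)) -
          θ / 6 * qV (W x) (specMat (V a) (μ a)))]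
        have := mul_le_mul_of_nonneg_left (ha (θ / 6) (by positivity) hθ₀) (Nat.cast_nonneg (α := ℝ) n)
        linarith) (h0 m) (one_sub_povm_posSemidef h0 h1 m)
    simp only [← hl] at h2
    refine h2.trans (add_le_add (le_of_eq ?_) (mul_le_mul_of_nonneg_left ?_ (Real.exp_pos _).le))
    · rw [sub_mul, one_mul, reTr_sub, reTr, reTr_tensorSeq _ fun k => (hW _).2, Complex.one_re]
    · exact Finset.single_le_sum (f := fun a => reTr (Pov m * σ a))
        (fun a _ => reTr_mul_nonneg (h0 m) (hσ0 a)) (Finset.mem_univ a)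
  have hsum : ∑ m, ∑ a, reTr (Pov m * σ a) = Fintype.card κ := by
    rw [Finset.sum_comm]
    have : ∀ a, ∑ m, reTr (Pov m * σ a) = 1 := fun a => by
      rw [← reTr_sum, ← Finset.sum_mul, h1, one_mul, hσtr]
    simp [this]
  have htot := Finset.sum_le_sum fun m (_ : m ∈ Finset.univ) => hkey m
  rw [Finset.sum_add_distrib, ← Finset.mul_sum (a := Real.exp b), hsum, Finset.sum_const,
    Finset.card_univ, Fintype.card_fin, nsmul_eq_mul] at htot
  have h3 : Real.exp (b - n * R) * Real.exp (n * R) = Real.exp b := by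
    rw [← Real.exp_add]; ring_nf
  have h4 : Real.exp b * Fintype.card κ ≤ ⌈Real.exp (n * R)⌉₊ *
      (Fintype.card κ * Real.exp (b - n * R)) := by
    rw [← h3]
    have := mul_le_mul_of_nonneg_left hMe (mul_nonneg (Nat.cast_nonneg (α := ℝ) (Fintype.card κ))
      (Real.exp_pos (b - n * R)).le)
    linarith
  rw [one_div, inv_mul_eq_div, le_div_iff₀ hMR]
  linarith

end Converse

section SupportDomination

variable {d : ℕ}

/-- Diagonal entries of `ρ` in the orthonormal basis given by the columns of `V`. -/
def diagWt (V ρ : Matrix (Fin d) (Fin d) ℂ) (j : Fin d) : ℝ := reTr (ρ * specMat V (Pi.single j 1))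

lemma diagWt_nonneg (V : Matrix (Fin d) (Fin d) ℂ) {ρ : Matrix (Fin d) (Fin d) ℂ}
    (hρ : ρ.PosSemidef) (j : Fin d) : 0 ≤ diagWt V ρ j :=
  reTr_mul_nonneg hρ (specMat_posSemidef V fun i => by by_cases h : i = j <;> simp [h])

lemma reTr_mul_specMat (V ρ : Matrix (Fin d) (Fin d) ℂ) (g : Fin d → ℝ) :
    reTr (ρ * specMat V g) = ∑ j, diagWt V ρ j * g j := by
  have h : specMat V g = ∑ j, (g j : ℂ) • specMat V (Pi.single j 1) := by
    simp only [specMat_smul]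
    simp only [specMat]
    rw [← Finset.sum_mul, ← Finset.mul_sum]
    congr 2
    ext a b
    by_cases hab : a = b
    · subst hab
      simp only [Matrix.sum_apply, Matrix.diagonal_apply_eq, ← Complex.ofReal_sum]
      simp [Pi.single_apply]
    · simp [Matrix.sum_apply, hab]
  rw [h, Finset.mul_sum, reTr_sum]
  refine Finset.sum_congr rfl fun j _ => ?_
  rw [Matrix.mul_smul, reTr_smul, diagWt, mul_comm]

lemma diagWt_specMat (U V : Matrix (Fin d) (Fin d) ℂ) (f : Fin d → ℝ) (j : Fin d) :
    diagWt V (specMat U f) j = ∑ i, f i * overlap U V i j := by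
  rw [diagWt, reTr_specMat_mul]
  simp [Pi.single_apply]

lemma sum_diagWt {V : Matrix (Fin d) (Fin d) ℂ} (hV : V.conjTranspose * V = 1)
    (ρ : Matrix (Fin d) (Fin d) ℂ) : ∑ j, diagWt V ρ j = reTr ρ := by
  have := reTr_mul_specMat V ρ (fun _ => 1)
  rw [specMat_const hV] at this
  simpa using this.symm

/-- The kernel of `τ` carries no weight of `ρ`. -/
def SuppDom (ρ τ : Matrix (Fin d) (Fin d) ℂ) : Prop :=
  ∀ (V : Matrix (Fin d) (Fin d) ℂ) (g : Fin d → ℝ), V.conjTranspose * V = 1 → τ = specMat V g →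
    ∀ j, g j = 0 → diagWt V ρ j = 0

lemma SuppDom.refl (ρ : Matrix (Fin d) (Fin d) ℂ) : SuppDom ρ ρ := by
  rintro V g hV rfl j hj
  rw [diagWt_specMat, Finset.sum_eq_single j] <;> simp +contextual [overlap_self hV, hj]

lemma mlog_specMat {V : Matrix (Fin d) (Fin d) ℂ} (hV : V.conjTranspose * V = 1) (g : Fin d → ℝ) :
    mlog (specMat V g) = specMat V (fun j => Real.log (g j)) := matFun_specMat hV g _

lemma diagWt_eq_zero_and_le_of_shift {ρ V : Matrix (Fin d) (Fin d) ℂ} (hρ : ρ.PosSemidef)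
    {g : Fin d → ℝ} (hg : ∀ j, 0 ≤ g j) {K : ℝ}
    (hK : ∀ s, 0 < s → s < 1 → K ≤ ∑ j, diagWt V ρ j * Real.log (g j + s)) :
    (∀ j, g j = 0 → diagWt V ρ j = 0) ∧ K ≤ ∑ j, diagWt V ρ j * Real.log (g j) := by
  have hev : ∀ᶠ s in nhdsWithin (0 : ℝ) (Set.Ioi 0), 0 < s ∧ s < 1 :=
    Filter.eventually_of_mem (Ioo_mem_nhdsGT zero_lt_one) fun s hs => hs
  have hdom : ∀ j, g j = 0 → diagWt V ρ j = 0 := by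
    intro j hj
    by_contra hne
    have hpos : 0 < diagWt V ρ j := lt_of_le_of_ne (diagWt_nonneg V hρ j) (Ne.symm hne)
    set A := ∑ i ∈ Finset.univ.erase j, diagWt V ρ i * Real.log (g i + 1)
    have h1 : ∀ᶠ s in nhdsWithin (0 : ℝ) (Set.Ioi 0), Real.log s < (K - A) / diagWt V ρ j :=
      Real.tendsto_log_nhdsGT_zero.eventually (Filter.eventually_lt_atBot _)
    obtain ⟨s, hs1, hs0, hs2⟩ := (h1.and hev).exists
    have h2 := hK s hs0 hs2
    rw [← Finset.add_sum_erase _ _ (Finset.mem_univ j), hj, zero_add] at h2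
    have h3 : ∑ i ∈ Finset.univ.erase j, diagWt V ρ i * Real.log (g i + s) ≤ A :=
      Finset.sum_le_sum fun i _ => mul_le_mul_of_nonneg_left
        (Real.log_le_log (by linarith [hg i]) (by linarith)) (diagWt_nonneg V hρ i)
    rw [lt_div_iff₀' hpos] at hs1
    linarith
  refine ⟨hdom, ge_of_tendsto ?_ (hev.mono fun s hs => hK s hs.1 hs.2)⟩
  refine tendsto_finsetSum _ fun j _ => ?_
  by_cases hj : g j = 0
  · simp [hdom j hj]
  · refine Filter.Tendsto.const_mul _ ?_
    have hc : ContinuousAt (fun s : ℝ => Real.log (g j + s)) 0 :=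
      ContinuousAt.log (by fun_prop) (by simpa using hj)
    simpa using hc.tendsto.mono_left nhdsWithin_le_nhds

lemma specMat_add_const {V : Matrix (Fin d) (Fin d) ℂ} (hV : V.conjTranspose * V = 1)
    (g : Fin d → ℝ) (s : ℝ) : specMat V (fun j => g j + s) = specMat V g + (s : ℂ) • 1 := by
  rw [← specMat_const hV, specMat_add]

open scoped MatrixOrder in
/-- Operator monotonicity of the logarithm, allowing singular arguments. -/
lemma SuppDom.mono {ρ τ τ' : Matrix (Fin d) (Fin d) ℂ} (hρ : ρ.PosSemidef) (hτ : τ.PosSemidef)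
    (hτ' : τ'.PosSemidef) {c : ℝ} (hc : 0 < c) (hle : (τ' - (c : ℂ) • τ).PosSemidef)
    (hdom : SuppDom ρ τ) :
    SuppDom ρ τ' ∧ Real.log c * reTr ρ + reTr (ρ * mlog τ) ≤ reTr (ρ * mlog τ') := by
  have key : ∀ (V' : Matrix (Fin d) (Fin d) ℂ) (g' : Fin d → ℝ), V'.conjTranspose * V' = 1 →
      τ' = specMat V' g' → (∀ j, g' j = 0 → diagWt V' ρ j = 0) ∧
        Real.log c * reTr ρ + reTr (ρ * mlog τ) ≤ ∑ j, diagWt V' ρ j * Real.log (g' j) := by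
    rintro V' g' hV' rfl
    obtain ⟨V, hV, g, rfl⟩ := exists_specMat hτ.1
    have hg := specMat_nonneg_of_posSemidef hV hτ
    have hg' := specMat_nonneg_of_posSemidef hV' hτ'
    refine diagWt_eq_zero_and_le_of_shift hρ hg' fun s hs0 hs1 => ?_
    have hle2 : specMat V (fun j => c * g j + s) ≤ specMat V' (fun j => g' j + s) := by
      rw [specMat_add_const hV, specMat_add_const hV', ← specMat_smul]
      refine Matrix.le_iff.mpr ?_
      rwa [add_sub_add_right_eq_sub]
    have hlog := specMat_log_le hV hV' (fun j => by
      have := mul_nonneg hc.le (hg j); linarith) hle2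
    have h2 := reTr_mul_le_mul hρ (Matrix.le_iff.mp hlog)
    rw [reTr_mul_specMat, reTr_mul_specMat] at h2
    refine le_trans ?_ h2
    rw [mlog_specMat hV, reTr_mul_specMat, ← sum_diagWt hV, Finset.mul_sum, ← Finset.sum_add_distrib]
    refine Finset.sum_le_sum fun j _ => ?_
    by_cases hj : g j = 0
    · simp [hdom V g hV rfl j hj]
    · have hj' : 0 < g j := lt_of_le_of_ne (hg j) (Ne.symm hj)
      have h3 : Real.log (c * g j) ≤ Real.log (c * g j + s) :=
        Real.log_le_log (by positivity) (by linarith)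
      rw [Real.log_mul hc.ne' hj] at h3
      have := mul_le_mul_of_nonneg_left h3 (diagWt_nonneg V hρ j)
      linarith
  refine ⟨fun V' g' hV' h => (key V' g' hV' h).1, ?_⟩
  obtain ⟨V', hV', g', h⟩ := exists_specMat hτ'.1
  refine (key V' g' hV' h).2.trans (le_of_eq ?_)
  rw [h, mlog_specMat hV', reTr_mul_specMat]

lemma qD_eq (ρ τ : Matrix (Fin d) (Fin d) ℂ) :
    qD ρ τ = reTr (ρ * mlog ρ) - reTr (ρ * mlog τ) := by
  rw [qD, mul_sub, reTr_sub]

lemma SuppDom.qD_le {ρ τ τ' : Matrix (Fin d) (Fin d) ℂ} (hρ : IsDensity ρ) (hτ : τ.PosSemidef)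
    (hτ' : τ'.PosSemidef) {c : ℝ} (hc : 0 < c) (hle : (τ' - (c : ℂ) • τ).PosSemidef)
    (hdom : SuppDom ρ τ) : qD ρ τ' ≤ qD ρ τ - Real.log c := by
  have := (hdom.mono hρ.1 hτ hτ' hc hle).2
  rw [reTr, hρ.2, Complex.one_re, mul_one] at this
  rw [qD_eq, qD_eq]; linarith

lemma IsDensity.reTr_eq {ρ : Matrix (Fin d) (Fin d) ℂ} (hρ : IsDensity ρ) : reTr ρ = 1 := by
  rw [reTr, hρ.2, Complex.one_re]

/-- Klein's inequality. -/
lemma SuppDom.qD_nonneg {ρ τ : Matrix (Fin d) (Fin d) ℂ} (hρ : IsDensity ρ) (hτ : IsDensity τ)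
    (hdom : SuppDom ρ τ) : 0 ≤ qD ρ τ := by
  obtain ⟨U, hU, f, rfl⟩ := exists_specMat hρ.1.1
  obtain ⟨V, hV, g, rfl⟩ := exists_specMat hτ.1.1
  have hf := specMat_nonneg_of_posSemidef hU hρ.1
  have hg := specMat_nonneg_of_posSemidef hV hτ.1
  have hf1 := hρ.reTr_eq
  have hg1 := hτ.reTr_eq
  rw [reTr_specMat hU] at hf1
  rw [reTr_specMat hV] at hg1
  rw [qD_specMat hU hV]
  have hzero : ∑ i, ∑ j, (f i * overlap U V i j - g j * overlap U V i j) = 0 := by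
    simp only [Finset.sum_sub_distrib]
    rw [sum_mul_overlap hU hV, hf1, Finset.sum_comm]
    simp_rw [← Finset.mul_sum, overlap_sum_left hU hV, mul_one, hg1, sub_self]
  rw [← hzero]
  refine Finset.sum_le_sum fun i _ => Finset.sum_le_sum fun j _ => ?_
  have hw := overlap_nonneg U V i j
  by_cases hgj : g j = 0
  · have h1 := hdom V g hV rfl j hgj
    rw [diagWt_specMat] at h1
    have h2 := (Finset.sum_eq_zero_iff_of_nonneg fun i _ => mul_nonneg (hf i)
      (overlap_nonneg U V i j)).mp h1 i (Finset.mem_univ i)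
    simp [h2, hgj]
  · have hgpos : 0 < g j := lt_of_le_of_ne (hg j) (Ne.symm hgj)
    by_cases hfi : f i = 0
    · simp only [hfi]; nlinarith
    · have hfpos : 0 < f i := lt_of_le_of_ne (hf i) (Ne.symm hfi)
      have h3 := Real.log_le_sub_one_of_pos (div_pos hgpos hfpos)
      rw [Real.log_div hgj hfi] at h3
      have h4 := mul_le_mul_of_nonneg_left h3 (mul_nonneg (hf i) hw)
      have h5 : f i * overlap U V i j * (g j / f i - 1) = g j * overlap U V i j - f i * overlap U V i j := by
        field_simp
      rw [h5] at h4
      linarith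

end SupportDomination

section Capacity

variable {X : Type} [Fintype X] {d : ℕ}

lemma avgState_posSemidef {Q : X → ℝ} {W : X → Matrix (Fin d) (Fin d) ℂ}
    (hW : ∀ x, IsDensity (W x)) (hQ : ∀ x, 0 ≤ Q x) : (avgState Q W).PosSemidef :=
  Matrix.posSemidef_sum _ fun x _ => (hW x).1.smul (by exact_mod_cast hQ x)

lemma avgState_isDensity {Q : X → ℝ} {W : X → Matrix (Fin d) (Fin d) ℂ}
    (hW : ∀ x, IsDensity (W x)) (hQ : IsProbDist Q) : IsDensity (avgState Q W) := by
  refine ⟨avgState_posSemidef hW hQ.1, ?_⟩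
  simp only [avgState, Matrix.trace_sum, Matrix.trace_smul, (hW _).2, smul_eq_mul, mul_one]
  exact_mod_cast hQ.2

lemma avgState_sub_posSemidef {Q : X → ℝ} {W : X → Matrix (Fin d) (Fin d) ℂ}
    (hW : ∀ x, IsDensity (W x)) (hQ : ∀ x, 0 ≤ Q x) (x : X) :
    (avgState Q W - (Q x : ℂ) • W x).PosSemidef := by
  classical
  rw [avgState, ← Finset.add_sum_erase _ _ (Finset.mem_univ x), add_sub_cancel_left]
  exact Matrix.posSemidef_sum _ fun y _ => (hW y).1.smul (by exact_mod_cast hQ y)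

lemma avgState_mix (P Q : X → ℝ) (W : X → Matrix (Fin d) (Fin d) ℂ) (t : ℝ) :
    avgState (fun x => (1 - t) * P x + t * Q x) W =
      ((1 - t : ℝ) : ℂ) • avgState P W + (t : ℂ) • avgState Q W := by
  simp only [avgState, Finset.smul_sum, ← Finset.sum_add_distrib, smul_smul, ← add_smul]
  push_cast; rfl

lemma avgState_single [DecidableEq X] (W : X → Matrix (Fin d) (Fin d) ℂ) (x : X) :
    avgState (Pi.single x 1) W = W x := by
  rw [avgState, Finset.sum_eq_single x] <;> simp +contextual

lemma isProbDist_single [DecidableEq X] (x : X) : IsProbDist (Pi.single x (1 : ℝ)) :=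
  ⟨fun y => by by_cases h : y = x <;> simp [h], by simp⟩

lemma IsProbDist.mix {P Q : X → ℝ} (hP : IsProbDist P) (hQ : IsProbDist Q) {t : ℝ} (ht0 : 0 ≤ t)
    (ht1 : t ≤ 1) : IsProbDist (fun x => (1 - t) * P x + t * Q x) :=
  ⟨fun x => add_nonneg (mul_nonneg (by linarith) (hP.1 x)) (mul_nonneg ht0 (hQ.1 x)), by
    rw [Finset.sum_add_distrib, ← Finset.mul_sum, ← Finset.mul_sum, hP.2, hQ.2]; ring⟩

lemma reTr_avgState_mul (Q : X → ℝ) (W : X → Matrix (Fin d) (Fin d) ℂ)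
    (A : Matrix (Fin d) (Fin d) ℂ) :
    reTr (avgState Q W * A) = ∑ x, Q x * reTr (W x * A) := by
  simp only [avgState, Finset.sum_mul, reTr_sum, Matrix.smul_mul, reTr_smul]

/-- The compensation identity. -/
lemma sum_qD_eq (Q : X → ℝ) (W : X → Matrix (Fin d) (Fin d) ℂ) (τ : Matrix (Fin d) (Fin d) ℂ) :
    ∑ x, Q x * qD (W x) τ = mutualInfo Q W + qD (avgState Q W) τ := by
  simp only [mutualInfo, qD_eq, reTr_avgState_mul, mul_sub, Finset.sum_sub_distrib]
  ring

lemma qD_self (ρ : Matrix (Fin d) (Fin d) ℂ) : qD ρ ρ = 0 := by rw [qD_eq, sub_self]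

lemma suppDom_avgState {Q : X → ℝ} {W : X → Matrix (Fin d) (Fin d) ℂ}
    (hW : ∀ x, IsDensity (W x)) (hQ : ∀ x, 0 ≤ Q x) {x : X} (hx : 0 < Q x) :
    SuppDom (W x) (avgState Q W) :=
  (SuppDom.mono (hW x).1 (hW x).1 (avgState_posSemidef hW hQ) hx (avgState_sub_posSemidef hW hQ x)
    (SuppDom.refl _)).1

lemma qD_avgState_le {Q : X → ℝ} {W : X → Matrix (Fin d) (Fin d) ℂ}
    (hW : ∀ x, IsDensity (W x)) (hQ : ∀ x, 0 ≤ Q x) {x : X} (hx : 0 < Q x) :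
    qD (W x) (avgState Q W) ≤ - Real.log (Q x) := by
  have := (SuppDom.refl (W x)).qD_le (hW x) (hW x).1 (avgState_posSemidef hW hQ) hx
    (avgState_sub_posSemidef hW hQ x)
  rwa [qD_self, zero_sub] at this

lemma mutualInfo_le_card {Q : X → ℝ} {W : X → Matrix (Fin d) (Fin d) ℂ}
    (hW : ∀ x, IsDensity (W x)) (hQ : ∀ x, 0 ≤ Q x) : mutualInfo Q W ≤ Fintype.card X := by
  rw [mutualInfo, ← nsmul_one, Fintype.card, ← Finset.sum_const]
  refine Finset.sum_le_sum fun x _ => ?_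
  rcases (hQ x).eq_or_lt with h | h
  · rw [← h]; simp
  · have h1 := mul_le_mul_of_nonneg_left (qD_avgState_le hW hQ h) h.le
    have h2 := mul_le_mul_of_nonneg_left (Real.one_sub_inv_le_log_of_pos h) h.le
    rw [mul_sub, mul_inv_cancel₀ h.ne'] at h2
    linarith

lemma mutualInfo_le_capacity {Q : X → ℝ} {W : X → Matrix (Fin d) (Fin d) ℂ}
    (hW : ∀ x, IsDensity (W x)) (hQ : IsProbDist Q) : mutualInfo Q W ≤ capacity W :=
  le_csSup ⟨Fintype.card X, by rintro c ⟨P, hP, rfl⟩; exact mutualInfo_le_card hW hP.1⟩ ⟨Q, hQ, rfl⟩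

lemma mutualInfo_single [DecidableEq X] (W : X → Matrix (Fin d) (Fin d) ℂ) (x : X) :
    mutualInfo (Pi.single x 1) W = 0 := by
  rw [mutualInfo, avgState_single, Finset.sum_eq_single x] <;>
    simp +contextual [qD_self]

lemma mixed_sub_posSemidef {σ ρ : Matrix (Fin d) (Fin d) ℂ} (hρ : ρ.PosSemidef) {s t : ℝ}
    (ht : 0 ≤ t) : ((s : ℂ) • σ + (t : ℂ) • ρ - (s : ℂ) • σ).PosSemidef := by
  rw [add_sub_cancel_left]
  exact hρ.smul (by exact_mod_cast ht)

lemma IsDensity.one_sub_posSemidef {ρ : Matrix (Fin d) (Fin d) ℂ} (hρ : IsDensity ρ) :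
    (1 - ρ).PosSemidef := by
  obtain ⟨U, hU, f, rfl⟩ := exists_specMat hρ.1.1
  have hf := specMat_nonneg_of_posSemidef hU hρ.1
  have hf1 := hρ.reTr_eq
  rw [reTr_specMat hU] at hf1
  have h : (1 : Matrix (Fin d) (Fin d) ℂ) - specMat U f = specMat U (fun i => 1 + (-1) * f i) := by
    rw [← specMat_add, ← specMat_smul, specMat_const hU]; simp [sub_eq_add_neg]
  rw [h]
  refine specMat_posSemidef U fun i => ?_
  have := Finset.single_le_sum (fun i _ => hf i) (Finset.mem_univ i)
  linarith

/-- The Karush–Kuhn–Tucker conditions for a capacity-achieving input distribution. -/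
lemma qD_le_capacity {P : X → ℝ} {W : X → Matrix (Fin d) (Fin d) ℂ}
    (hW : ∀ x, IsDensity (W x)) (hP : IsProbDist P) (hI : mutualInfo P W = capacity W) (x : X) :
    SuppDom (W x) (avgState P W) ∧ qD (W x) (avgState P W) ≤ capacity W := by
  classical
  have hσ := avgState_isDensity hW hP
  have hmix : ∀ t, 0 < t → t < 1 → SuppDom (W x) (((1 - t : ℝ) : ℂ) • avgState P W + (t : ℂ) • W x) ∧
      qD (W x) (((1 - t : ℝ) : ℂ) • avgState P W + (t : ℂ) • W x) ≤ capacity W := by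
    intro t ht0 ht1
    have hQ := hP.mix (isProbDist_single x) ht0.le ht1.le
    have hτ := avgState_mix P (Pi.single x 1) W t
    rw [avgState_single] at hτ
    have hτd := avgState_isDensity hW hQ
    have hQx : 0 < (fun y => (1 - t) * P y + t * (Pi.single x 1 : X → ℝ) y) x := by
      have := hP.1 x
      simp; nlinarith
    have hdx := suppDom_avgState hW hQ.1 hQx
    have hC := mutualInfo_le_capacity hW hQ
    have hsum := sum_qD_eq (fun y => (1 - t) * P y + t * (Pi.single x 1 : X → ℝ) y) W
      (avgState (fun y => (1 - t) * P y + t * (Pi.single x 1 : X → ℝ) y) W)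
    rw [qD_self, add_zero] at hsum
    rw [← hsum] at hC
    simp only [add_mul, Finset.sum_add_distrib, mul_assoc, ← Finset.mul_sum] at hC
    rw [sum_qD_eq, hI, hτ, Finset.sum_eq_single (a := x) (by simp +contextual)
      (by simp), Pi.single_eq_same, one_mul] at hC
    rw [hτ] at hdx hτd
    have h0 : SuppDom (avgState P W) (((1 - t : ℝ) : ℂ) • avgState P W + (t : ℂ) • W x) :=
      (SuppDom.mono hσ.1 hσ.1 hτd.1 (c := 1 - t) (by linarith)
        (mixed_sub_posSemidef (hW x).1 ht0.le) (SuppDom.refl _)).1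
    have h1 := mul_nonneg (by linarith : (0 : ℝ) ≤ 1 - t) (h0.qD_nonneg hσ hτd)
    refine ⟨hdx, ?_⟩
    nlinarith
  have key : ∀ (V : Matrix (Fin d) (Fin d) ℂ) (μ : Fin d → ℝ), V.conjTranspose * V = 1 →
      avgState P W = specMat V μ → (∀ j, μ j = 0 → diagWt V (W x) j = 0) ∧
        reTr (W x * mlog (W x)) - capacity W ≤ ∑ j, diagWt V (W x) j * Real.log (μ j) := by
    intro V μ hV hμ
    have hμ0 : ∀ j, 0 ≤ μ j := specMat_nonneg_of_posSemidef hV (hμ ▸ hσ.1)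
    refine diagWt_eq_zero_and_le_of_shift (hW x).1 hμ0 fun t ht0 ht1 => ?_
    obtain ⟨hd, hq⟩ := hmix t ht0 ht1
    have hshift := specMat_add_const hV μ t
    have hpsd : (specMat V fun j => μ j + t).PosSemidef :=
      specMat_posSemidef V fun j => by linarith [hμ0 j]
    have hτ : (((1 - t : ℝ) : ℂ) • avgState P W + (t : ℂ) • W x).PosSemidef :=
      (hσ.1.smul (by exact_mod_cast (by linarith : (0 : ℝ) ≤ 1 - t))).add
        ((hW x).1.smul (by exact_mod_cast ht0.le))
    have := (SuppDom.mono (hW x).1 hτ hpsd one_pos (by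
      have h2 : (specMat V fun j => μ j + t) - ((1 : ℝ) : ℂ) •
          (((1 - t : ℝ) : ℂ) • avgState P W + (t : ℂ) • W x) =
          (t : ℂ) • (avgState P W + (1 - W x)) := by
        rw [hshift, ← hμ]
        push_cast
        module
      rw [h2]
      exact (hσ.1.add (hW x).one_sub_posSemidef).smul (by exact_mod_cast ht0.le)) hd).2
    rw [qD_eq] at hq
    rw [Real.log_one, zero_mul, zero_add, mlog_specMat hV, reTr_mul_specMat] at this
    linarith
  obtain ⟨V, hV, μ, hμ⟩ := exists_specMat hσ.1.1
  refine ⟨fun V' μ' hV' hμ' => (key V' μ' hV' hμ').1, ?_⟩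
  rw [qD_eq, hμ, mlog_specMat hV, reTr_mul_specMat]
  linarith [(key V μ hV hμ).2]

end Capacity

section PeripheralVariance

variable {X : Type} [Fintype X] {d : ℕ} {W : X → Matrix (Fin d) (Fin d) ℂ}

lemma IsDensity.qV_nonneg {ρ τ : Matrix (Fin d) (Fin d) ℂ} (hρ : IsDensity ρ)
    (hτ : τ.IsHermitian) : 0 ≤ qV ρ τ := by
  obtain ⟨U, hU, f, rfl⟩ := exists_specMat hρ.1.1
  obtain ⟨V, hV, g, rfl⟩ := exists_specMat hτ
  have hf1 := hρ.reTr_eq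
  rw [reTr_specMat hU] at hf1
  exact MDQ.qV_nonneg hU hV (specMat_nonneg_of_posSemidef hU hρ.1) hf1 g

lemma Vmin_le_infoVar (hW : ∀ x, IsDensity (W x)) {P : X → ℝ} (hP : IsProbDist P)
    (hI : mutualInfo P W = capacity W) : Vmin W ≤ infoVar P W := by
  refine csInf_le ⟨0, ?_⟩ ⟨P, hP, hI, rfl⟩
  rintro v ⟨Q, hQ, -, rfl⟩
  exact Finset.sum_nonneg fun x _ => mul_nonneg (hQ.1 x)
    ((hW x).qV_nonneg (avgState_isDensity hW hQ).1.1)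

lemma exists_infoVar_lt (hV : 0 < Vmin W) {b : ℝ} (hb : Vmin W < b) :
    ∃ P : X → ℝ, IsProbDist P ∧ mutualInfo P W = capacity W ∧ infoVar P W < b := by
  have hne : { v : ℝ | ∃ P : X → ℝ, IsProbDist P ∧ mutualInfo P W = capacity W ∧
      v = infoVar P W }.Nonempty := by
    by_contra h
    rw [Set.not_nonempty_iff_eq_empty] at h
    rw [Vmin, h, Real.sInf_empty] at hV
    exact lt_irrefl _ hV
  obtain ⟨v, ⟨P, hP, hI, rfl⟩, hv⟩ := exists_lt_of_csInf_lt hne hb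
  exact ⟨P, hP, hI, hv⟩

lemma nonempty_of_Vmin_pos (hV : 0 < Vmin W) : Nonempty X := by
  obtain ⟨P, hP, -⟩ := exists_infoVar_lt hV (lt_add_one _)
  by_contra h
  rw [not_nonempty_iff] at h
  simpa using hP.2

lemma capacity_pos (hW : ∀ x, IsDensity (W x)) (hV : 0 < Vmin W) : 0 < capacity W := by
  classical
  obtain ⟨x⟩ := nonempty_of_Vmin_pos hV
  have hx := isProbDist_single x
  have hC := mutualInfo_le_capacity hW hx
  rw [mutualInfo_single] at hC
  refine lt_of_le_of_ne hC fun h => ?_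
  have h1 := Vmin_le_infoVar hW hx (by rw [mutualInfo_single, h])
  have h2 : infoVar (Pi.single x 1) W = 0 := by
    rw [infoVar, avgState_single, Finset.sum_eq_single x] <;>
      simp +contextual [qV, qD, reTr]
  linarith

/-- Around every input distribution there is a reference state for which the tilted
information density is controlled. -/
lemma exists_reference_state (hW : ∀ x, IsDensity (W x)) (hV : 0 < Vmin W) {Q₀ : X → ℝ}
    (hQ₀ : IsProbDist Q₀) : ∃ σ, IsDensity σ ∧ (∀ x, SuppDom (W x) σ) ∧ ∃ θ₀ > 0,
      ∀ᶠ Q in nhds Q₀, IsProbDist Q → ∀ θ, 0 < θ → θ ≤ θ₀ →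
        ∑ x, Q x * (qD (W x) σ - θ * qV (W x) σ) ≤ capacity W - θ * (Vmin W / 2) := by
  have hcont : ∀ F : X → ℝ, Continuous fun Q : X → ℝ => ∑ x, Q x * F x := fun F => by fun_prop
  have hsplit : ∀ (Q : X → ℝ) σ θ, ∑ x, Q x * (qD (W x) σ - θ * qV (W x) σ) =
      ∑ x, Q x * qD (W x) σ - θ * ∑ x, Q x * qV (W x) σ := fun Q σ θ => by
    rw [Finset.mul_sum, ← Finset.sum_sub_distrib]
    exact Finset.sum_congr rfl fun x _ => by ring
  by_cases hI : mutualInfo Q₀ W = capacity W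
  · refine ⟨avgState Q₀ W, avgState_isDensity hW hQ₀, fun x => (qD_le_capacity hW hQ₀ hI x).1, 1,
      one_pos, ?_⟩
    have hlt : Vmin W / 2 < ∑ x, Q₀ x * qV (W x) (avgState Q₀ W) :=
      lt_of_lt_of_le (by linarith) (Vmin_le_infoVar hW hQ₀ hI)
    filter_upwards [(hcont _).continuousAt.eventually (lt_mem_nhds hlt)] with Q hQ hQp θ hθ _
    rw [hsplit]
    have h1 : ∑ x, Q x * qD (W x) (avgState Q₀ W) ≤ ∑ x, Q x * capacity W :=
      Finset.sum_le_sum fun x _ => mul_le_mul_of_nonneg_left (qD_le_capacity hW hQ₀ hI x).2 (hQp.1 x)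
    rw [← Finset.sum_mul, hQp.2, one_mul] at h1
    nlinarith
  · have hg : 0 < capacity W - mutualInfo Q₀ W :=
      sub_pos.mpr (lt_of_le_of_ne (mutualInfo_le_capacity hW hQ₀) hI)
    set g := capacity W - mutualInfo Q₀ W with hgdef
    have := nonempty_of_Vmin_pos hV
    have hcard : (0 : ℝ) < Fintype.card X := by exact_mod_cast Fintype.card_pos
    have hunif : IsProbDist (fun _ : X => (Fintype.card X : ℝ)⁻¹) :=
      ⟨fun _ => by positivity, by simp [hcard.ne']⟩
    set t := 1 - Real.exp (-(g / 2)) with ht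
    have ht1 : 1 - t = Real.exp (-(g / 2)) := by ring
    have ht0 : 0 < t := sub_pos.mpr ((Real.exp_lt_exp.mpr (by linarith : -(g / 2) < 0)).trans_eq Real.exp_zero)
    have htlt : 0 < 1 - t := ht1 ▸ Real.exp_pos _
    have hQt := hQ₀.mix hunif ht0.le (by linarith)
    have hσ := avgState_isDensity hW hQt
    have hmix := avgState_mix Q₀ (fun _ : X => (Fintype.card X : ℝ)⁻¹) W t
    refine ⟨_, hσ, fun x => suppDom_avgState hW hQt.1 ?_, g / 4 / (Vmin W / 2), by positivity, ?_⟩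
    · have := mul_nonneg htlt.le (hQ₀.1 x)
      have : 0 < t * (Fintype.card X : ℝ)⁻¹ := by positivity
      linarith
    set σ := avgState (fun x => (1 - t) * Q₀ x + t * (Fintype.card X : ℝ)⁻¹) W with hσdef
    have hle : ∑ x, Q₀ x * qD (W x) σ ≤ ∑ x, Q₀ x * (qD (W x) (avgState Q₀ W) + g / 2) := by
      refine Finset.sum_le_sum fun x _ => ?_
      rcases (hQ₀.1 x).eq_or_lt with h | h
      · simp [← h]
      · refine mul_le_mul_of_nonneg_left ?_ h.le
        have := (suppDom_avgState hW hQ₀.1 h).qD_le (hW x) (avgState_posSemidef hW hQ₀.1) hσ.1 htlt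
          (hmix ▸ mixed_sub_posSemidef (avgState_posSemidef hW hunif.1) ht0.le)
        rw [ht1, Real.log_exp] at this
        linarith
    have hlt : ∑ x, Q₀ x * qD (W x) σ < capacity W - g / 4 := by
      simp only [mul_add, Finset.sum_add_distrib, ← Finset.sum_mul, hQ₀.2] at hle
      have : ∑ x, Q₀ x * qD (W x) (avgState Q₀ W) = mutualInfo Q₀ W := rfl
      linarith
    filter_upwards [(hcont _).continuousAt.eventually (gt_mem_nhds hlt)] with Q hQ hQp θ hθ hθ'
    rw [hsplit]
    have h1 : 0 ≤ ∑ x, Q x * qV (W x) σ :=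
      Finset.sum_nonneg fun x _ => mul_nonneg (hQp.1 x) ((hW x).qV_nonneg hσ.1.1)
    have h2 := mul_nonneg hθ.le h1
    rw [le_div_iff₀ (by positivity)] at hθ'
    linarith

lemma exists_nonneg_bound {ι : Type*} [Finite ι] (f : ι → ℝ) : ∃ B, 0 ≤ B ∧ ∀ i, |f i| ≤ B := by
  cases nonempty_fintype ι
  exact ⟨∑ i, |f i|, Finset.sum_nonneg fun i _ => abs_nonneg _, fun i =>
    Finset.single_le_sum (f := fun i => |f i|) (fun i _ => abs_nonneg _) (Finset.mem_univ i)⟩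

/-- A uniform lower bound on the optimal error, with constants depending only on the channel. -/
lemma exists_le_optErr (hW : ∀ x, IsDensity (W x)) (hV : 0 < Vmin W) :
    ∃ L B θ₀ : ℝ, 0 ≤ L ∧ 0 < θ₀ ∧ ∀ (θ : ℝ) (n : ℕ) (R : ℝ), 0 < θ → θ ≤ θ₀ → 0 < n →
      (1 / 8) * Real.exp (-4 * n * θ ^ 2 * B ^ 2) -
        L * Real.exp (n * (capacity W - θ / 6 * (Vmin W / 2)) + Real.log 2 / θ - n * R) ≤
      optErr W n R := by
  classical
  have := nonempty_of_Vmin_pos hV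
  choose! σ hσ hdom τ hτ0 hτ using fun Q₀ (hQ₀ : IsProbDist Q₀) =>
    exists_reference_state hW hV hQ₀
  obtain ⟨T, hT, hcover⟩ := (isCompact_stdSimplex ℝ X).elim_nhds_subcover
    (fun Q₀ => {Q | IsProbDist Q → ∀ θ, 0 < θ → θ ≤ τ Q₀ →
        ∑ x, Q x * (qD (W x) (σ Q₀) - θ * qV (W x) (σ Q₀)) ≤ capacity W - θ * (Vmin W / 2)})
    (fun Q₀ hQ₀ => hτ Q₀ hQ₀)
  choose U hU l hl using fun x => exists_specMat (hW x).1.1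
  choose V hVu μ hμ using fun Q : T => exists_specMat (hσ Q (hT Q Q.2)).1.1
  have hl0 : ∀ x i, 0 ≤ l x i := fun x =>
    specMat_nonneg_of_posSemidef (hU x) (hl x ▸ (hW x).1)
  have hμ0 : ∀ a j, 0 ≤ μ a j := fun a =>
    specMat_nonneg_of_posSemidef (hVu a) (hμ a ▸ (hσ a (hT a a.2)).1)
  have hμ1 : ∀ a, ∑ j, μ a j = 1 := fun a => by
    have := (hσ a (hT a a.2)).reTr_eq
    rwa [hμ a, reTr_specMat (hVu a)] at this
  obtain ⟨B, hB0, hB⟩ := exists_nonneg_bound fun p : T × X × Fin d × Fin d =>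
    Real.log (l p.2.1 p.2.2.1) - Real.log (μ p.1 p.2.2.2) -
      qD (W p.2.1) (specMat (V p.1) (μ p.1))
  obtain ⟨θ₁, hθ₁, hθ₁T⟩ : ∃ θ₁ : ℝ, 0 < θ₁ ∧ ∀ Q ∈ T, θ₁ ≤ τ Q := by
    rcases T.eq_empty_or_nonempty with h | h
    · exact ⟨1, one_pos, by simp [h]⟩
    · obtain ⟨Q, hQ, hmin⟩ := T.exists_min_image τ h
      exact ⟨τ Q, hτ0 Q (hT Q hQ), hmin⟩
  refine ⟨Fintype.card T, B, min (6 * θ₁) (1 / (2 * B + 1)), by positivity,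
    lt_min (by positivity) (by positivity), fun θ n R hθ hθle hn => ?_⟩
  refine le_optErr hW hU hl hl0 hVu hμ0 hμ1 ?_ hB0 (fun a x i j => hB (a, x, i, j)) (θ₀ := θ₁) ?_ hθ
    ?_ ?_ hn R
  · intro a x i j hne
    refine lt_of_le_of_ne (hμ0 a j) fun h => hne ?_
    have h1 := hdom a (hT a a.2) x (V a) (μ a) (hVu a) (hμ a) j h.symm
    rw [hl x, diagWt_specMat] at h1
    exact (Finset.sum_eq_zero_iff_of_nonneg fun i _ => mul_nonneg (hl0 x i)
      (overlap_nonneg (U x) (V a) i j)).mp h1 i (Finset.mem_univ i)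
  · intro Q hQ
    have hQs : Q ∈ stdSimplex ℝ X := hQ
    obtain ⟨Q₁, hQ₁, hmem⟩ := Set.mem_iUnion₂.mp (hcover hQs)
    refine ⟨⟨Q₁, hQ₁⟩, fun θ hθ hθle => ?_⟩
    rw [← hμ ⟨Q₁, hQ₁⟩]
    exact hmem hQ θ hθ (hθle.trans (hθ₁T Q₁ hQ₁))
  · have h1 := hθle.trans (min_le_right _ _)
    rw [le_div_iff₀ (by positivity)] at h1
    linarith
  · have h1 := hθle.trans (min_le_left _ _)
    linarith

end PeripheralVariance

section Asymptotics

variable {X : Type} [Fintype X] {d : ℕ} {W : X → Matrix (Fin d) (Fin d) ℂ}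

lemma tendsto_nat_mul_sq {a : ℕ → ℝ} (ha : Tendsto (fun n : ℕ => a n * Real.sqrt n) atTop atTop) :
    Tendsto (fun n : ℕ => (n : ℝ) * a n ^ 2) atTop atTop := by
  refine (ha.atTop_mul_atTop₀ ha).congr fun n => ?_
  have := Real.mul_self_sqrt (Nat.cast_nonneg (α := ℝ) n)
  linear_combination a n ^ 2 * this

lemma eventually_pos_of_tendsto {a : ℕ → ℝ}
    (ha : Tendsto (fun n : ℕ => a n * Real.sqrt n) atTop atTop) : ∀ᶠ n in atTop, 0 < a n :=
  (ha.eventually_gt_atTop 0).mono fun _ hn => pos_of_mul_pos_left hn (Real.sqrt_nonneg _)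

lemma exists_eventually_le_optErr (hW : ∀ x, IsDensity (W x)) (hV : 0 < Vmin W) {a : ℕ → ℝ}
    (ha0 : Tendsto a atTop (nhds 0))
    (ha1 : Tendsto (fun n : ℕ => a n * Real.sqrt n) atTop atTop) :
    ∃ K, ∀ᶠ n in atTop,
      (1 / 16) * Real.exp (-K * (n * a n ^ 2)) ≤ optErr W n (capacity W - a n) := by
  obtain ⟨L, B, θ₀, hL, hθ₀, h⟩ := exists_le_optErr hW hV
  set κ := 24 / Vmin W with hκdef
  have hκ : 0 < κ := by positivity
  refine ⟨4 * κ ^ 2 * B ^ 2, ?_⟩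
  have hsmall : ∀ c : ℝ, 0 < c → ∀ᶠ n in atTop, a n ≤ c := fun c hc =>
    (ha0.eventually (gt_mem_nhds hc)).mono fun _ hn => le_of_lt hn
  have hbig := tendsto_nat_mul_sq ha1
  filter_upwards [eventually_pos_of_tendsto ha1, hsmall 1 one_pos, hsmall (θ₀ / κ) (by positivity),
    hsmall (1 / (16 * κ ^ 2 * B ^ 2 + 1)) (by positivity),
    hbig.eventually_ge_atTop (2 * (Real.log 2 / κ)), hbig.eventually_ge_atTop (64 * L),
    eventually_gt_atTop 0] with n hpos h1 hθ hK hc hL' hn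
  rw [le_div_iff₀ hκ] at hθ
  rw [le_div_iff₀ (by positivity)] at hK
  have hn' : (0 : ℝ) < n := by exact_mod_cast hn
  refine le_trans ?_ (h (κ * a n) n (capacity W - a n) (by positivity) (by linarith) hn)
  have hexp : n * (capacity W - κ * a n / 6 * (Vmin W / 2)) + Real.log 2 / (κ * a n) -
      n * (capacity W - a n) = -(n * a n) + Real.log 2 / κ / a n := by
    rw [hκdef]; field_simp; ring
  have hlog : Real.log 2 / κ / a n ≤ n * a n / 2 := by
    rw [div_le_iff₀ hpos]; nlinarith
  have hKna : 4 * κ ^ 2 * B ^ 2 * (n * a n ^ 2) ≤ n * a n / 4 := by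
    have := mul_le_mul_of_nonneg_left hK (mul_nonneg hn'.le hpos.le)
    nlinarith [mul_nonneg hn'.le (sq_nonneg (a n))]
  have hna : 64 * L ≤ n * a n := by
    have := mul_le_mul_of_nonneg_left h1 (mul_nonneg hn'.le hpos.le)
    nlinarith
  rw [hexp]
  have hE : L * Real.exp (-(n * a n) + Real.log 2 / κ / a n) ≤
      (1 / 16) * Real.exp (-(4 * κ ^ 2 * B ^ 2) * (n * a n ^ 2)) := by
    have h2 : -(n * a n) + Real.log 2 / κ / a n ≤
        -(n * a n / 4) + -(4 * κ ^ 2 * B ^ 2) * (n * a n ^ 2) := by linarith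
    have h3 : L * Real.exp (-(n * a n / 4)) ≤ 1 / 16 := by
      rw [Real.exp_neg, ← div_eq_mul_inv, div_le_iff₀ (Real.exp_pos _)]
      linarith [Real.add_one_le_exp (n * a n / 4)]
    calc _ ≤ L * Real.exp (-(n * a n / 4) + -(4 * κ ^ 2 * B ^ 2) * (n * a n ^ 2)) :=
          mul_le_mul_of_nonneg_left (Real.exp_le_exp.mpr h2) hL
      _ = L * Real.exp (-(n * a n / 4)) * Real.exp (-(4 * κ ^ 2 * B ^ 2) * (n * a n ^ 2)) := by
          rw [Real.exp_add, ← mul_assoc L]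
      _ ≤ _ := mul_le_mul_of_nonneg_right h3 (Real.exp_pos _).le
  have hX : (-4 * n * (κ * a n) ^ 2 * B ^ 2 : ℝ) = -(4 * κ ^ 2 * B ^ 2) * (n * a n ^ 2) := by ring
  rw [hX]
  linarith

/-- Second-order expansion of the cumulant generating function of a finite random variable. -/
lemma exists_sum_mul_exp_le {ι : Type*} [Fintype ι] {w Z : ι → ℝ} (hw : ∀ i, 0 ≤ w i)
    (hw1 : ∑ i, w i = 1) {C v : ℝ} (hC : ∑ i, w i * Z i = C) (hv : ∑ i, w i * (Z i - C) ^ 2 = v)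
    {δ : ℝ} (hδ : 0 < δ) :
    ∃ s₀ > 0, ∀ s, 0 < s → s ≤ s₀ →
      ∑ i, w i * Real.exp (-s * Z i) ≤ Real.exp (-s * C + s ^ 2 * (v / 2 + δ)) := by
  obtain ⟨B, hB0, hB⟩ := exists_nonneg_bound fun i => Z i - C
  refine ⟨min (1 / (B + 1)) (δ / (B ^ 3 + 1)), by positivity, fun s hs hs' => ?_⟩
  have hs1 := hs'.trans (min_le_left _ _)
  have hs2 := hs'.trans (min_le_right _ _)
  rw [le_div_iff₀ (by positivity)] at hs1 hs2
  have hterm : ∀ i, Real.exp (-s * Z i) ≤ Real.exp (-s * C) *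
      (1 - s * (Z i - C) + s ^ 2 / 2 * (Z i - C) ^ 2 + s ^ 2 * δ) := by
    intro i
    have hy : |-s * (Z i - C)| ≤ s * B := by
      rw [abs_mul, abs_neg, abs_of_pos hs]
      exact mul_le_mul_of_nonneg_left (hB i) hs.le
    have h1 := (abs_le.mp (Real.exp_bound (x := -s * (Z i - C)) (by linarith) (n := 3)
      (by norm_num))).2
    have h2 : |-s * (Z i - C)| ^ 3 ≤ (s * B) ^ 3 := pow_le_pow_left₀ (abs_nonneg _) hy 3
    have h3 : (s * B) ^ 3 ≤ s ^ 2 * δ := by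
      have := mul_le_mul_of_nonneg_left hs2 (sq_nonneg s)
      nlinarith [pow_pos hs 3]
    have h4 : 0 ≤ |-s * (Z i - C)| ^ 3 := by positivity
    have h5 : -s * Z i = -s * C + -s * (Z i - C) := by ring
    rw [h5, Real.exp_add]
    refine mul_le_mul_of_nonneg_left ?_ (Real.exp_pos _).le
    have h6 : 1 - s * (Z i - C) + s ^ 2 / 2 * (Z i - C) ^ 2 + s ^ 2 * δ =
        1 + -s * (Z i - C) + (-s * (Z i - C)) ^ 2 / 2 + s ^ 2 * δ := by ring
    rw [h6]
    generalize -s * (Z i - C) = y at *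
    norm_num [Finset.sum_range_succ, Nat.factorial] at h1
    linarith
  have hsum : ∑ i, w i * (1 - s * (Z i - C) + s ^ 2 / 2 * (Z i - C) ^ 2 + s ^ 2 * δ) =
      1 + s ^ 2 * (v / 2 + δ) := by
    have : ∀ i, w i * (1 - s * (Z i - C) + s ^ 2 / 2 * (Z i - C) ^ 2 + s ^ 2 * δ) =
        w i * (1 + s * C + s ^ 2 * δ) - s * (w i * Z i) + s ^ 2 / 2 * (w i * (Z i - C) ^ 2) :=
      fun i => by ring
    simp only [this, Finset.sum_add_distrib, Finset.sum_sub_distrib, ← Finset.mul_sum,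
      ← Finset.sum_mul, hw1, hC, hv]
    ring
  calc ∑ i, w i * Real.exp (-s * Z i)
      ≤ ∑ i, w i * (Real.exp (-s * C) *
        (1 - s * (Z i - C) + s ^ 2 / 2 * (Z i - C) ^ 2 + s ^ 2 * δ)) :=
        Finset.sum_le_sum fun i _ => mul_le_mul_of_nonneg_left (hterm i) (hw i)
    _ = Real.exp (-s * C) * (1 + s ^ 2 * (v / 2 + δ)) := by
        rw [← hsum, Finset.mul_sum]
        exact Finset.sum_congr rfl fun i _ => by ring
    _ ≤ Real.exp (-s * C) * Real.exp (s ^ 2 * (v / 2 + δ)) :=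
        mul_le_mul_of_nonneg_left (by linarith [Real.add_one_le_exp (s ^ 2 * (v / 2 + δ))])
          (Real.exp_pos _).le
    _ = _ := (Real.exp_add _ _).symm

lemma qD_eq_capacity (hW : ∀ x, IsDensity (W x)) {P : X → ℝ} (hP : IsProbDist P)
    (hI : mutualInfo P W = capacity W) {x : X} (hx : P x ≠ 0) :
    qD (W x) (avgState P W) = capacity W := by
  have h0 : ∑ x, P x * (capacity W - qD (W x) (avgState P W)) = 0 := by
    simp only [mul_sub, Finset.sum_sub_distrib, ← Finset.sum_mul, hP.2]
    rw [← hI, mutualInfo]; ring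
  have := (Finset.sum_eq_zero_iff_of_nonneg fun x _ => mul_nonneg (hP.1 x)
    (sub_nonneg.mpr (qD_le_capacity hW hP hI x).2)).mp h0 x (Finset.mem_univ x)
  rcases mul_eq_zero.mp this with h | h
  · exact absurd h hx
  · linarith

lemma exists_optErr_le (hW : ∀ x, IsDensity (W x)) {P : X → ℝ} (hP : IsProbDist P)
    (hI : mutualInfo P W = capacity W) {δ : ℝ} (hδ : 0 < δ) :
    ∃ s₀ > 0, ∀ s, 0 < s → s ≤ s₀ → ∀ (n : ℕ) (R : ℝ), 0 ≤ R →
      optErr W n R ≤ 8 * Real.exp (n * (s * (R - capacity W) + s ^ 2 * (infoVar P W / 2 + δ))) := by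
  have hσ := avgState_isDensity hW hP
  choose U hU l hl using fun x => exists_specMat (hW x).1.1
  obtain ⟨V, hV, μ, hμ⟩ := exists_specMat hσ.1.1
  have hl0 : ∀ x i, 0 ≤ l x i := fun x =>
    specMat_nonneg_of_posSemidef (hU x) (hl x ▸ (hW x).1)
  have hμ0 : ∀ j, 0 ≤ μ j := specMat_nonneg_of_posSemidef hV (hμ ▸ hσ.1)
  have hl1 : ∀ x, ∑ i, l x i = 1 := fun x => by
    rw [← reTr_specMat (hU x), ← hl x, (hW x).reTr_eq]
  have hD : ∀ x, ∑ i, ∑ j, l x i * overlap (U x) V i j * (Real.log (l x i) - Real.log (μ j)) =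
      qD (W x) (avgState P W) := fun x => by
    conv_rhs => rw [hl x, hμ]
    rw [qD_specMat (hU x) hV]
  have hQ : ∀ x, ∑ i, ∑ j, l x i * overlap (U x) V i j *
      (Real.log (l x i) - Real.log (μ j)) ^ 2 =
      qV (W x) (avgState P W) + qD (W x) (avgState P W) ^ 2 := fun x => by
    conv_rhs => rw [hl x, hμ]
    rw [qV_specMat (hU x) hV]
  have hO : ∀ x, ∑ i, l x i * ∑ j, overlap (U x) V i j = 1 := fun x => by
    simp only [overlap_sum_right (hU x) hV, mul_one, hl1]
  obtain ⟨s₀, hs₀, hs⟩ := exists_sum_mul_exp_le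
    (w := fun p : X × Fin d × Fin d => P p.1 * (l p.1 p.2.1 * overlap (U p.1) V p.2.1 p.2.2))
    (Z := fun p => Real.log (l p.1 p.2.1) - Real.log (μ p.2.2)) (C := capacity W)
    (v := infoVar P W)
    (fun p => mul_nonneg (hP.1 _) (mul_nonneg (hl0 _ _) (overlap_nonneg _ _ _ _)))
    (by simp only [Fintype.sum_prod_type, ← Finset.mul_sum, hO, mul_one, hP.2])
    (by simp only [Fintype.sum_prod_type, mul_assoc (P _), ← Finset.mul_sum, hD]; exact hI)
    (by
      simp only [Fintype.sum_prod_type, mul_assoc (P _), ← Finset.mul_sum]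
      refine Finset.sum_congr rfl fun x _ => ?_
      by_cases hx : P x = 0
      · simp [hx]
      · congr 1
        have hc := qD_eq_capacity hW hP hI hx
        have h1 := hD x
        have h2 := hQ x
        have h3 := hO x
        rw [hc] at h1 h2
        have h4 : ∀ i j, l x i * overlap (U x) V i j *
            (Real.log (l x i) - Real.log (μ j) - capacity W) ^ 2 =
            l x i * overlap (U x) V i j * (Real.log (l x i) - Real.log (μ j)) ^ 2 -
            2 * capacity W * (l x i * overlap (U x) V i j * (Real.log (l x i) - Real.log (μ j))) +
            capacity W ^ 2 * (l x i * overlap (U x) V i j) := fun i j => by ring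
        simp only [h4, Finset.sum_add_distrib, Finset.sum_sub_distrib, ← Finset.mul_sum, h1, h2, h3]
        ring) hδ
  refine ⟨min s₀ (1 / 2), by positivity, fun s hs0 hsle n R hR => ?_⟩
  have hs1 : s < 1 := (hsle.trans (min_le_right _ _)).trans_lt (by norm_num)
  have hF : ∑ x, P x * ∑ i, ∑ j, l x i ^ (1 - s) * μ j ^ s * overlap (U x) V i j ≤
      Real.exp (-s * capacity W + s ^ 2 * (infoVar P W / 2 + δ)) := by
    refine le_of_eq_of_le ?_ (hs s hs0 (hsle.trans (min_le_left _ _)))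
    simp only [Fintype.sum_prod_type, mul_assoc (P _), ← Finset.mul_sum]
    refine Finset.sum_congr rfl fun x _ => ?_
    rcases (hP.1 x).eq_or_lt with hx | hx
    · simp [← hx]
    congr 1
    refine Finset.sum_congr rfl fun i _ => Finset.sum_congr rfl fun j _ => ?_
    by_cases hz : l x i * overlap (U x) V i j = 0
    · rw [hz, zero_mul]
      rcases mul_eq_zero.mp hz with h | h
      · rw [h, Real.zero_rpow (by linarith)]; ring
      · rw [h, mul_zero]
    · have hli : 0 < l x i := lt_of_le_of_ne (hl0 x i) fun h => hz (by rw [← h, zero_mul])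
      have hμj : 0 < μ j := by
        refine lt_of_le_of_ne (hμ0 j) fun h => hz ?_
        have h1 := suppDom_avgState hW hP.1 hx V μ hV hμ j h.symm
        rw [hl x, diagWt_specMat] at h1
        exact (Finset.sum_eq_zero_iff_of_nonneg fun i _ => mul_nonneg (hl0 x i)
          (overlap_nonneg (U x) V i j)).mp h1 i (Finset.mem_univ i)
      have h2 : l x i ^ (1 - s) * μ j ^ s =
          l x i * Real.exp (-s * (Real.log (l x i) - Real.log (μ j))) := by
        rw [Real.rpow_def_of_pos hli, Real.rpow_def_of_pos hμj, ← Real.exp_add]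
        conv_rhs => rw [← Real.exp_log hli, Real.log_exp, ← Real.exp_add]
        congr 1; ring
      rw [h2]; ring
  have hF0 : 0 ≤ ∑ x, P x * ∑ i, ∑ j, l x i ^ (1 - s) * μ j ^ s * overlap (U x) V i j :=
    Finset.sum_nonneg fun x _ => mul_nonneg (hP.1 x) <| Finset.sum_nonneg fun i _ =>
      Finset.sum_nonneg fun j _ => mul_nonneg (mul_nonneg (Real.rpow_nonneg (hl0 x i) _)
        (Real.rpow_nonneg (hμ0 j) _)) (overlap_nonneg _ _ _ _)
  have hM : (⌈Real.exp (n * R)⌉₊ : ℝ) ^ s ≤ 2 * Real.exp (n * (s * R)) := by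
    have h1 : (⌈Real.exp (n * R)⌉₊ : ℝ) ≤ 2 * Real.exp (n * R) := by
      have := Nat.ceil_lt_add_one (Real.exp_pos (n * R)).le
      have := Real.one_le_exp (mul_nonneg n.cast_nonneg hR)
      linarith
    calc (⌈Real.exp (n * R)⌉₊ : ℝ) ^ s ≤ (2 * Real.exp (n * R)) ^ s :=
          Real.rpow_le_rpow (Nat.cast_nonneg _) h1 hs0.le
      _ = 2 ^ s * Real.exp (n * (s * R)) := by
          rw [Real.mul_rpow (by norm_num) (Real.exp_pos _).le, ← Real.exp_mul]
          congr 2; ring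
      _ ≤ 2 * Real.exp (n * (s * R)) := by
          refine mul_le_mul_of_nonneg_right ?_ (Real.exp_pos _).le
          calc (2 : ℝ) ^ s ≤ 2 ^ (1 : ℝ) := Real.rpow_le_rpow_of_exponent_le (by norm_num) hs1.le
            _ = 2 := Real.rpow_one 2
  calc optErr W n R ≤ 4 * (⌈Real.exp (n * R)⌉₊ : ℝ) ^ s *
        (∑ x, P x * ∑ i, ∑ j, l x i ^ (1 - s) * μ j ^ s * overlap (U x) V i j) ^ n :=
        optErr_le_pow hW hP hU hl hl0 hV hμ hμ0 hs0 hs1 n R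
    _ ≤ 4 * (2 * Real.exp (n * (s * R))) *
        Real.exp (-s * capacity W + s ^ 2 * (infoVar P W / 2 + δ)) ^ n := by
        gcongr
    _ = _ := by
        rw [← Real.exp_nat_mul, show (4 : ℝ) * (2 * Real.exp (n * (s * R))) =
          8 * Real.exp (n * (s * R)) by ring, mul_assoc, ← Real.exp_add]
        congr 2; ring

end Asymptotics

/-- **Moderate deviation achievability for classical-quantum channel coding.** -/
theorem moderate_deviation_achievability_cq
    {X : Type} [Fintype X] {d : ℕ}
    (W : X → Matrix (Fin d) (Fin d) ℂ) (hW : ∀ x, IsDensity (W x))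
    (hV : 0 < Vmin W)
    (a : ℕ → ℝ)
    (ha0 : Filter.Tendsto a Filter.atTop (nhds 0))
    (ha1 : Filter.Tendsto (fun n : ℕ => a n * Real.sqrt n) Filter.atTop Filter.atTop) :
    Filter.limsup
      (fun n : ℕ => (1 / ((n : ℝ) * (a n) ^ 2)) *
        Real.log (optErr W n (capacity W - a n))) Filter.atTop ≤
      -1 / (2 * Vmin W) := by
  obtain ⟨K, hK⟩ := exists_eventually_le_optErr hW hV ha0 ha1
  have hbig := tendsto_nat_mul_sq ha1
  have hpos := eventually_pos_of_tendsto ha1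
  have hcob : IsCoboundedUnder (· ≤ ·) atTop
      (fun n : ℕ => (1 / ((n : ℝ) * (a n) ^ 2)) * Real.log (optErr W n (capacity W - a n))) := by
    refine IsBoundedUnder.isCoboundedUnder_le ⟨-Real.log 16 - K, ?_⟩
    rw [eventually_map]
    filter_upwards [hK, hbig.eventually_ge_atTop 1] with n hn h1
    have h0 : 0 < (n : ℝ) * a n ^ 2 := by linarith
    have h2 := Real.log_le_log (by positivity) hn
    rw [Real.log_mul (by norm_num) (Real.exp_pos _).ne', Real.log_exp, one_div, Real.log_inv] at h2
    rw [one_div, inv_mul_eq_div, le_div_iff₀ h0]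
    have := Real.log_nonneg (by norm_num : (1 : ℝ) ≤ 16)
    nlinarith
  refine le_of_forall_gt_imp_ge_of_dense fun b hb => limsup_le_of_le hcob ?_
  have hcont : ContinuousAt (fun v : ℝ => -1 / (2 * v)) (Vmin W) :=
    ContinuousAt.div (by fun_prop) (by fun_prop) (by positivity)
  obtain ⟨r, hr, hball⟩ := Metric.eventually_nhds_iff.mp (hcont.eventually (gt_mem_nhds hb))
  obtain ⟨P, hP, hI, hlt⟩ := exists_infoVar_lt hV (lt_add_of_pos_right (Vmin W) hr)
  have hle := Vmin_le_infoVar hW hP hI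
  set v := infoVar P W
  have hv : 0 < v := hV.trans_le hle
  have hvb : -1 / (2 * v) < b := hball (by
    rw [Real.dist_eq, abs_of_nonneg (by linarith)]; linarith)
  set δ := (b - -1 / (2 * v)) * v ^ 2 / 2 with hδdef
  have hδ : 0 < δ := by
    have := sub_pos.mpr hvb
    positivity
  obtain ⟨s₀, hs₀, hopt⟩ := exists_optErr_le hW hP hI hδ
  have hc : 0 < b - -1 / (2 * v) := sub_pos.mpr hvb
  filter_upwards [hK, hpos, hbig.eventually_ge_atTop (2 * Real.log 8 / (b - -1 / (2 * v))),
    hbig.eventually_gt_atTop 0,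
    ha0.eventually (gt_mem_nhds (capacity_pos hW hV)),
    ha0.eventually (gt_mem_nhds (mul_pos hs₀ hv))] with n hn ha h8 h0 hC hs
  have hpos' : 0 < optErr W n (capacity W - a n) := lt_of_lt_of_le (by positivity) hn
  have h1 := hopt (a n / v) (by positivity) (by rw [div_le_iff₀ hv]; exact hs.le) n
    (capacity W - a n) (by linarith)
  have h2 := Real.log_le_log hpos' h1
  rw [Real.log_mul (by norm_num) (Real.exp_pos _).ne', Real.log_exp] at h2
  have h3 : (n : ℝ) * (a n / v * (capacity W - a n - capacity W) + (a n / v) ^ 2 * (v / 2 + δ)) =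
      (n * a n ^ 2) * (-1 / (2 * v) + (b - -1 / (2 * v)) / 2) := by
    rw [hδdef]; field_simp; ring
  rw [h3] at h2
  rw [div_le_iff₀ hc] at h8
  rw [one_div, inv_mul_eq_div, div_le_iff₀ h0]
  linarith

end MDQ
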